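/- For every g ≥ 4, the nonorientable surface group of genus g, i.e., the group with presentation ⟨a₁,…,a_g | a₁²a₂²⋯a_g² = 1⟩, satisfies the strong generic free group property with respect to every finite generating set. -/

import Mathlib

open Filter Set

/-- The ball of radius `m` in a group with respect to a set `S`: the elements expressible as
a product of at most `m` elements of `S ∪ S⁻¹`. -/
def wordBall {G : Type*} [Group G] (S : Set G) (m : ℕ) : Set G :=
  {g | ∃ l : List G, l.length ≤ m ∧ (∀ x ∈ l, x ∈ S ∨ x⁻¹ ∈ S) ∧ l.prod = g}

/-- A tuple `(g₁, …, gₙ)` is a free basis tuple if the induced homomorphism from the free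
group of rank `n` sending the `i`-th free generator to `gᵢ` is injective. -/
def IsFreeBasisTuple {G : Type*} [Group G] {n : ℕ} (x : Fin n → G) : Prop :=
  Function.Injective (FreeGroup.lift x)

/-- A group has the strong generic free group property with respect to a generating set `S`
if for every `n ≥ 1` the proportion of free basis `n`-tuples in the ball of radius `m`
tends to `1` as `m → ∞`. -/
def StrongGenericFreeGroupProperty {G : Type*} [Group G] (S : Set G) : Prop :=
  ∀ n : ℕ, 1 ≤ n →
    Filter.Tendsto
      (fun m : ℕ =>
        ({x : Fin n → G | (∀ i, x i ∈ wordBall S m) ∧ IsFreeBasisTuple x}.ncard : ℝ) /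
          ((wordBall S m).ncard : ℝ) ^ n)
      Filter.atTop (nhds 1)

/-- A group has the strong generic free group property with respect to every finite
generating set. -/
def HasStrongGenericFreeGroupProperty (G : Type*) [Group G] : Prop :=
  ∀ S : Set G, S.Finite → Subgroup.closure S = ⊤ → StrongGenericFreeGroupProperty S

/-- The nonorientable surface relator `a₁²a₂²⋯a_g²` in the free group on `g` generators. -/
def nonorientableSurfaceRelator (g : ℕ) : FreeGroup (Fin g) :=
  (List.ofFn fun i : Fin g => (FreeGroup.of i) ^ 2).prod

/-- The nonorientable surface group of genus `g`, with presentation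
`⟨a₁,…,a_g | a₁²a₂²⋯a_g²⟩`. -/
def NonorientableSurfaceGroup (g : ℕ) : Type :=
  PresentedGroup {nonorientableSurfaceRelator g}

instance (g : ℕ) : Group (NonorientableSurfaceGroup g) := by
  unfold NonorientableSurfaceGroup; infer_instance

/-- The length of the longest common prefix of two lists. -/
def List.commonPrefixLength {β : Type*} [DecidableEq β] : List β → List β → ℕ
  | a :: l, b :: l' => if a = b then commonPrefixLength l l' + 1 else 0
  | _, _ => 0

namespace List

variable {β : Type*} [DecidableEq β]

theorem commonPrefixLength_comm (l l' : List β) :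
    commonPrefixLength l l' = commonPrefixLength l' l := by
  induction l generalizing l' with
  | nil => cases l' <;> simp [commonPrefixLength]
  | cons a l ih => cases l' <;> simp [commonPrefixLength, eq_comm, ih]

theorem commonPrefixLength_le_length_left (l l' : List β) :
    commonPrefixLength l l' ≤ l.length := by
  induction l generalizing l' with
  | nil => simp [commonPrefixLength]
  | cons a l ih =>
    cases l' with
    | nil => simp [commonPrefixLength]
    | cons b l' => simp only [commonPrefixLength]; split_ifs <;> simp [ih]

theorem min_commonPrefixLength_le (l₁ l₂ l₃ : List β) :
    min (commonPrefixLength l₁ l₂) (commonPrefixLength l₂ l₃) ≤ commonPrefixLength l₁ l₃ := by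
  induction l₂ generalizing l₁ l₃ with
  | nil => simp [commonPrefixLength]
  | cons b l₂ ih =>
    cases l₁ with
    | nil => simp [commonPrefixLength]
    | cons a l₁ =>
      cases l₃ with
      | nil => simp [commonPrefixLength]
      | cons c l₃ =>
        have := ih l₁ l₃
        simp only [commonPrefixLength]
        split_ifs <;> first | omega | simp_all

theorem commonPrefixLength_take (l : List β) (t : ℕ) (ht : t ≤ l.length) :
    commonPrefixLength (l.take t) l = t := by
  induction l generalizing t with
  | nil => simp_all [commonPrefixLength]
  | cons a l ih =>
    cases t with
    | zero => simp [commonPrefixLength]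
    | succ t => simp_all [commonPrefixLength]

end List

namespace FreeGroup

variable {α : Type*} [DecidableEq α]

theorem norm_mk_of_isReduced {L : List (α × Bool)} (h : IsReduced L) : (mk L).norm = L.length := by
  rw [norm, toWord_mk, h.reduce_eq]

theorem isReduced_invRev {L : List (α × Bool)} (h : IsReduced L) : IsReduced (invRev L) := by
  rw [isReduced_iff_reduce_eq, reduce_invRev, h.reduce_eq]

theorem norm_inv_mk_mul_mk (L₁ L₂ : List (α × Bool)) (h₁ : IsReduced L₁) (h₂ : IsReduced L₂) :
    ((mk L₁)⁻¹ * mk L₂).norm + 2 * L₁.commonPrefixLength L₂ = L₁.length + L₂.length := by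
  induction L₁ generalizing L₂ with
  | nil =>
    have h : (mk ([] : List (α × Bool))) = 1 := rfl
    simp [h, List.commonPrefixLength, norm_mk_of_isReduced h₂]
  | cons a l₁ ih =>
    cases L₂ with
    | nil =>
      have h : (mk ([] : List (α × Bool))) = 1 := rfl
      rw [h, mul_one, norm_inv_eq, norm_mk_of_isReduced h₁]
      simp [List.commonPrefixLength]
    | cons b l₂ =>
      by_cases hab : a = b
      · subst hab
        have e : ∀ l : List (α × Bool), mk (a :: l) = mk [a] * mk l := fun l => by simp [mul_mk]
        have h := ih l₂ (List.IsChain.tail h₁) (List.IsChain.tail h₂)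
        rw [e l₁, e l₂]
        simp only [mul_inv_rev, mul_assoc, inv_mul_cancel_left, List.commonPrefixLength, if_true,
          List.length_cons]
        omega
      · have hr : IsReduced (invRev (a :: l₁) ++ b :: l₂) := by
          refine List.isChain_append.2 ⟨isReduced_invRev h₁, h₂, ?_⟩
          intro x hx y hy
          simp only [invRev, List.map_cons, List.reverse_cons, List.getLast?_append,
            List.getLast?_singleton, Option.mem_def, Option.some_or, Option.some.injEq,
            List.head?_cons] at hx hy
          subst hx hy
          rcases a with ⟨a, s⟩
          rcases b with ⟨b, t⟩
          simp only [Prod.mk.injEq, not_and] at hab ⊢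
          intro h
          have := hab h
          cases s <;> cases t <;> simp_all
        rw [inv_mk, mul_mk, norm_mk_of_isReduced hr]
        simp [List.commonPrefixLength, hab]

/-- The length of the longest common prefix of the reduced words of two elements. -/
def commonPrefix (x y : FreeGroup α) : ℕ := x.toWord.commonPrefixLength y.toWord

theorem norm_inv_mul (x y : FreeGroup α) :
    (x⁻¹ * y).norm + 2 * commonPrefix x y = x.norm + y.norm := by
  have := norm_inv_mk_mul_mk x.toWord y.toWord isReduced_toWord isReduced_toWord
  rwa [mk_toWord, mk_toWord] at this

theorem norm_mul (x y : FreeGroup α) :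
    (x * y).norm + 2 * commonPrefix x⁻¹ y = x.norm + y.norm := by
  have := norm_inv_mul x⁻¹ y
  rwa [inv_inv, norm_inv_eq] at this

theorem commonPrefix_comm (x y : FreeGroup α) : commonPrefix x y = commonPrefix y x :=
  List.commonPrefixLength_comm _ _

theorem commonPrefix_le_left (x y : FreeGroup α) : commonPrefix x y ≤ x.norm :=
  List.commonPrefixLength_le_length_left _ _

theorem min_commonPrefix_le (x y z : FreeGroup α) :
    min (commonPrefix x y) (commonPrefix y z) ≤ commonPrefix x z :=
  List.min_commonPrefixLength_le _ _ _

/-- `u` is a prefix of `x`: the reduced word of `u` is an initial segment of that of `x`. -/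
def IsPrefix (u x : FreeGroup α) : Prop := u.norm + (u⁻¹ * x).norm = x.norm

theorem isPrefix_iff {u x : FreeGroup α} : IsPrefix u x ↔ commonPrefix u x = u.norm := by
  have := norm_inv_mul u x
  unfold IsPrefix
  omega

theorem exists_isPrefix (x : FreeGroup α) {t : ℕ} (ht : t ≤ x.norm) :
    ∃ u, IsPrefix u x ∧ u.norm = t := by
  have hr : IsReduced (x.toWord.take t) := List.IsChain.take isReduced_toWord t
  have hn : (mk (x.toWord.take t)).norm = t := by
    rw [norm_mk_of_isReduced hr, List.length_take]; exact min_eq_left ht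
  refine ⟨mk (x.toWord.take t), ?_, hn⟩
  rw [isPrefix_iff, hn, commonPrefix, toWord_mk, hr.reduce_eq]
  exact List.commonPrefixLength_take _ _ ht

theorem isPrefix_one (x : FreeGroup α) : IsPrefix 1 x := by simp [IsPrefix]

theorem isPrefix_refl (x : FreeGroup α) : IsPrefix x x := by simp [IsPrefix]

theorem IsPrefix.norm_le {u x : FreeGroup α} (h : IsPrefix u x) : u.norm ≤ x.norm := by
  unfold IsPrefix at h; omega

theorem IsPrefix.trans {u v x : FreeGroup α} (h : IsPrefix u v) (h' : IsPrefix v x) :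
    IsPrefix u x := by
  have := h.norm_le
  rw [isPrefix_iff] at *
  have := min_commonPrefix_le u v x
  have := commonPrefix_le_left u x
  omega

theorem IsPrefix.of_norm_le {u v x : FreeGroup α} (h : IsPrefix u x) (h' : IsPrefix v x)
    (hn : u.norm ≤ v.norm) : IsPrefix u v := by
  rw [isPrefix_iff] at *
  have := min_commonPrefix_le u x v
  rw [commonPrefix_comm x v] at this
  have := commonPrefix_le_left u v
  omega

theorem IsPrefix.eq_of_norm_eq {u v x : FreeGroup α} (h : IsPrefix u x) (h' : IsPrefix v x)
    (hn : u.norm = v.norm) : u = v := by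
  have := h.of_norm_le h' hn.le
  unfold IsPrefix at this
  have h0 : (u⁻¹ * v).norm = 0 := by omega
  rw [norm_eq_zero, inv_mul_eq_one] at h0
  exact h0

theorem isPrefix_one_right {u : FreeGroup α} (h : IsPrefix u 1) : u = 1 := by
  have := h.norm_le
  rw [norm_one, Nat.le_zero, norm_eq_zero] at this
  exact this

/-- A prefix of `x` is either a prefix of `p` or lies on the geodesic from `p` to `x`. -/
theorem IsPrefix.isPrefix_or {v p x : FreeGroup α} (h : IsPrefix v x) :
    IsPrefix v p ∨ IsPrefix (p⁻¹ * v) (p⁻¹ * x) := by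
  by_cases hv : IsPrefix v p
  · exact Or.inl hv
  right
  have e : (p⁻¹ * v)⁻¹ * (p⁻¹ * x) = v⁻¹ * x := by group
  rw [isPrefix_iff] at h hv
  unfold IsPrefix
  rw [e]
  have h1 := norm_inv_mul v x
  have h2 := norm_inv_mul p v
  have h3 := norm_inv_mul p x
  have h4 := min_commonPrefix_le v x p
  have h5 := min_commonPrefix_le p v x
  have h6 := min_commonPrefix_le v p x
  have h7 := min_commonPrefix_le p x v
  have h8 := commonPrefix_le_left v p
  rw [commonPrefix_comm x p] at h4
  rw [commonPrefix_comm v p] at *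
  rw [commonPrefix_comm x v] at *
  omega

/-- If `v` lies on the geodesic from `p` to `q`, then it is on one of the geodesics from `1`. -/
theorem isPrefix_or_isPrefix_of_isPrefix {v p q : FreeGroup α}
    (h : IsPrefix (p⁻¹ * v) (p⁻¹ * q)) : IsPrefix v p ∨ IsPrefix v q := by
  have e : (p⁻¹ * v)⁻¹ * (p⁻¹ * q) = v⁻¹ * q := by group
  rw [isPrefix_iff, isPrefix_iff]
  unfold IsPrefix at h
  rw [e] at h
  have h1 := norm_inv_mul v q
  have h2 := norm_inv_mul p v
  have h3 := norm_inv_mul p q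
  have h4 := min_commonPrefix_le v q p
  have h5 := min_commonPrefix_le p v q
  have h6 := min_commonPrefix_le v p q
  have h8 := commonPrefix_le_left v p
  have h9 := commonPrefix_le_left v q
  rw [commonPrefix_comm q p] at h4
  rw [commonPrefix_comm v p] at *
  omega

end FreeGroup

namespace FreeGroup

variable {α : Type*} [DecidableEq α]

/-- The element of the free group represented by a positive word. -/
def positive (L : List α) : FreeGroup α := mk (L.map fun a => (a, true))

omit [DecidableEq α] in
theorem isReduced_map_true (L : List α) : IsReduced (L.map fun a => (a, true)) := by
  unfold IsReduced
  induction L with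
  | nil => simp
  | cons a L ih => cases L <;> simp_all

omit [DecidableEq α] in
theorem positive_append (L L' : List α) : positive (L ++ L') = positive L * positive L' := by
  simp [positive, mul_mk]

theorem norm_positive (L : List α) : (positive L).norm = L.length := by
  rw [positive, norm_mk_of_isReduced (isReduced_map_true L), List.length_map]

theorem positive_injective : Function.Injective (positive (α := α)) := by
  intro L L' h
  have h := congrArg toWord h
  simp only [positive, toWord_mk, (isReduced_map_true _).reduce_eq] at h
  exact List.map_injective_iff.2 (fun a b hab => by simpa using hab) h

theorem norm_positive_pow (L : List α) (k : ℕ) :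
    (positive L ^ k).norm = k * (positive L).norm := by
  have : positive L ^ k = positive (List.replicate k L).flatten := by
    induction k with
    | zero => rfl
    | succ k ih => rw [pow_succ', ih, List.replicate_succ, List.flatten_cons, positive_append]
  rw [this, norm_positive, norm_positive]
  simp

/-- Substituting positive words with distinct first letters and distinct last letters for the
generators gives an injective homomorphism. -/
theorem injective_lift_positive {β : Type*} [DecidableEq β] (s : α → List β) (hs : ∀ x, s x ≠ [])
    (hhead : ∀ x y, (s x).head? = (s y).head? → x = y)
    (hlast : ∀ x y, (s x).getLast? = (s y).getLast? → x = y) :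
    Function.Injective (lift fun x => positive (s x)) := by
  let t : α × Bool → List (β × Bool) := fun p =>
    if p.2 then (s p.1).map (fun a => (a, true)) else invRev ((s p.1).map fun a => (a, true))
  have ht : ∀ p, t p ≠ [] := by
    rintro ⟨x, b⟩
    cases b <;> simp [t, invRev, hs]
  have htr : ∀ p, IsReduced (t p) := by
    rintro ⟨x, b⟩
    cases b
    · simpa [t] using isReduced_invRev (isReduced_map_true (s x))
    · simpa [t] using isReduced_map_true (s x)
  have hmk : ∀ L : List (α × Bool), lift (fun x => positive (s x)) (mk L) = mk (L.flatMap t) := by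
    intro L
    induction L with
    | nil => rfl
    | cons p L ih =>
      have e : mk (p :: L) = mk [p] * mk L := by simp [mul_mk]
      rw [e, MonoidHom.map_mul, ih, List.flatMap_cons, ← mul_mk]
      congr 1
      rcases p with ⟨x, b⟩
      cases b <;> simp [t, positive, inv_mk]
  have hred : ∀ L : List (α × Bool), IsReduced L → IsReduced (L.flatMap t) := by
    intro L hL
    unfold IsReduced
    rw [List.flatMap, List.isChain_flatten (by simp [ht])]
    refine ⟨fun l hl => ?_, ?_⟩
    · obtain ⟨p, -, rfl⟩ := List.mem_map.1 hl
      exact htr p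
    rw [List.isChain_map]
    refine List.IsChain.imp ?_ hL
    rintro ⟨x, b⟩ ⟨y, b'⟩ hxy u hu v hv huv
    simp only at hxy
    cases b <;> cases b' <;> simp only [t, if_true, Bool.false_eq_true, if_false, invRev,
      List.getLast?_map, List.head?_map, List.getLast?_reverse, List.head?_reverse,
      Option.mem_def, Option.map_eq_some_iff, Option.map_map] at hu hv
    · obtain ⟨p, hp, rfl⟩ := hu
      obtain ⟨q, hq, rfl⟩ := hv
      rfl
    · obtain ⟨p, hp, rfl⟩ := hu
      obtain ⟨q, hq, rfl⟩ := hv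
      simp only [Function.comp] at huv
      subst huv
      exact absurd (hxy (hhead x y (hp.trans hq.symm))) (by simp)
    · obtain ⟨p, hp, rfl⟩ := hu
      obtain ⟨q, hq, rfl⟩ := hv
      simp only [Function.comp] at huv
      subst huv
      exact absurd (hxy (hlast x y (hp.trans hq.symm))) (by simp)
    · obtain ⟨p, hp, rfl⟩ := hu
      obtain ⟨q, hq, rfl⟩ := hv
      rfl
  rw [injective_iff_map_eq_one]
  intro x hx
  rw [← mk_toWord (x := x), hmk, ← toWord_eq_nil_iff, toWord_mk,
    (hred _ isReduced_toWord).reduce_eq, List.flatMap_eq_nil_iff] at hx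
  rw [← toWord_eq_nil_iff]
  rcases h : x.toWord with _ | ⟨p, L⟩
  · rfl
  · exact absurd (hx p (by simp [h])) (ht p)

/-- A positive word that is not a proper rotation of itself generates its own centralizer. -/
theorem mem_zpowers_of_commute_positive (L : List α)
    (hrot : ∀ P Q : List α, P ++ Q = L → Q ++ P = L → P = [] ∨ Q = [])
    (hL : L ≠ []) (p : FreeGroup α) (hp : Commute p (positive L)) :
    p ∈ Subgroup.zpowers (positive L) := by
  set z := positive L with hz
  have hn : z.norm = L.length := norm_positive L
  have hpos : 0 < L.length := List.length_pos_iff.2 hL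
  have h2 : commonPrefix z⁻¹ z = 0 := by
    have h := norm_mul z z
    have h' := norm_positive_pow L 2
    rw [pow_two, ← hz] at h'
    omega
  induction hk : p.norm using Nat.strong_induction_on generalizing p with
  | _ k ih =>
    have key : ∀ q : FreeGroup α, q.norm = k → Commute q z → (z * q).norm = z.norm + q.norm →
        q ∈ Subgroup.zpowers z := by
      intro q hq hc hzq
      have hqz : IsPrefix q (z * q) := by
        unfold IsPrefix
        rw [← hc.eq, inv_mul_cancel_left]
        rw [hc.eq]; omega
      have hzz : IsPrefix z (z * q) := by
        unfold IsPrefix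
        rw [inv_mul_cancel_left]
        omega
      rcases le_total z.norm q.norm with h | h
      · have hzq' := hzz.of_norm_le hqz h
        unfold IsPrefix at hzq'
        have := ih (z⁻¹ * q).norm (by omega) (z⁻¹ * q)
          (Commute.mul_left ((Commute.refl z).inv_left) hc) rfl
        have h3 := Subgroup.mul_mem _ (Subgroup.mem_zpowers z) this
        rwa [mul_inv_cancel_left] at h3
      · have hqz' := hqz.of_norm_le hzz h
        have hr : ∀ x y : FreeGroup α, (x * y).norm = x.norm + y.norm →
            (x * y).toWord = x.toWord ++ y.toWord := by
          intro x y hxy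
          rw [toWord_mul]
          refine List.Sublist.eq_of_length (Red.sublist reduce.red) ?_
          rw [← toWord_mul, List.length_append]
          exact hxy
        unfold IsPrefix at hqz'
        have h4 : (q * (q⁻¹ * z)).toWord = q.toWord ++ (q⁻¹ * z).toWord :=
          hr _ _ (by rw [mul_inv_cancel_left]; omega)
        have h5 : ((q⁻¹ * z) * q).toWord = (q⁻¹ * z).toWord ++ q.toWord := by
          refine hr _ _ ?_
          rw [mul_assoc, ← hc.eq, inv_mul_cancel_left]; omega
        rw [mul_inv_cancel_left] at h4
        rw [mul_assoc, ← hc.eq, inv_mul_cancel_left] at h5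
        have hzw : z.toWord = L.map fun a => (a, true) := by
          rw [hz, positive, toWord_mk, (isReduced_map_true L).reduce_eq]
        rw [hzw] at h4 h5
        obtain ⟨P, Q, hPQ, hP, hQ⟩ := List.map_eq_append_iff.1 h4
        obtain ⟨Q', P', hQP, hQ', hP'⟩ := List.map_eq_append_iff.1 h5
        have inj : Function.Injective (List.map fun a : α => (a, true)) :=
          List.map_injective_iff.2 (fun a b hab => by simpa using hab)
        obtain rfl := inj (hP.trans hP'.symm)
        obtain rfl := inj (hQ.trans hQ'.symm)
        rcases hrot P Q hPQ.symm hQP.symm with rfl | rfl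
        · rw [List.map_nil, eq_comm, toWord_eq_nil_iff] at hP
          rw [hP]
          exact Subgroup.one_mem _
        · rw [List.map_nil, eq_comm, toWord_eq_nil_iff, inv_mul_eq_one] at hQ
          rw [hQ]
          exact Subgroup.mem_zpowers z
    have h3 := min_commonPrefix_le z⁻¹ p z
    have h4 := norm_mul z p
    have h5 := norm_inv_mul z p
    have h6 : (z * p⁻¹).norm = (z⁻¹ * p).norm := by
      rw [← norm_inv_eq, mul_inv_rev, inv_inv, (hp.inv_right).eq]
    rw [commonPrefix_comm p z] at h3
    by_cases h : commonPrefix z⁻¹ p = 0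
    · exact key p hk hp (by omega)
    · have := key p⁻¹ (by rw [norm_inv_eq, hk]) hp.inv_left
        (by rw [h6, norm_inv_eq]; omega)
      exact (Subgroup.inv_mem_iff _).1 this

end FreeGroup

namespace FreeGroup

variable {α : Type*} [DecidableEq α]

theorem IsPrefix.mul_left_of_pow {c y : FreeGroup α} (hc : ∀ k : ℕ, (c ^ k).norm = k * c.norm)
    {j : ℕ} (h : IsPrefix y (c ^ j)) : IsPrefix (c * y) (c ^ (j + 1)) ∧
      (c * y).norm = c.norm + y.norm := by
  unfold IsPrefix at *
  have h1 := norm_mul_le c y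
  have h2 := norm_mul_le (c * y) ((c * y)⁻¹ * c ^ (j + 1))
  have e : (c * y)⁻¹ * c ^ (j + 1) = y⁻¹ * c ^ j := by rw [pow_succ']; group
  rw [mul_inv_cancel_left] at h2
  rw [e] at h2 ⊢
  rw [hc] at h h2 ⊢
  have : (j + 1) * c.norm = j * c.norm + c.norm := by ring
  omega

theorem isPrefix_pow_pow {c : FreeGroup α} (hc : ∀ k : ℕ, (c ^ k).norm = k * c.norm) {i j : ℕ}
    (h : i ≤ j) : IsPrefix (c ^ i) (c ^ j) := by
  obtain ⟨k, rfl⟩ := Nat.exists_eq_add_of_le h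
  unfold IsPrefix
  rw [pow_add, inv_mul_cancel_left, ← pow_add, hc, hc, hc]
  ring

theorem norm_inv_pow {c : FreeGroup α} (hc : ∀ k : ℕ, (c ^ k).norm = k * c.norm) (k : ℕ) :
    (c⁻¹ ^ k).norm = k * (c⁻¹).norm := by
  rw [inv_pow, norm_inv_eq, norm_inv_eq, hc]

theorem isPrefix_pow_mul {c x : FreeGroup α} (hc : ∀ k : ℕ, (c ^ k).norm = k * c.norm) {j k : ℕ}
    (hk : 2 * j ≤ k) (hx : ¬ IsPrefix (c⁻¹ ^ j) x) : IsPrefix (c ^ j) (c ^ k * x) := by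
  have h1 := norm_inv_mul (c ^ k) (c ^ k * x)
  have h2 := norm_mul (c ^ k) x
  rw [inv_mul_cancel_left] at h1
  have h3 := isPrefix_iff.1 (isPrefix_pow_pow hc (show j ≤ k by omega))
  have h4 := isPrefix_iff.1 (isPrefix_pow_pow (norm_inv_pow hc) (show j ≤ k by omega))
  have h5 := min_commonPrefix_le (c ^ j) (c ^ k) (c ^ k * x)
  have h6 := min_commonPrefix_le (c⁻¹ ^ j) (c⁻¹ ^ k) x
  have h7 := commonPrefix_le_left (c⁻¹ ^ j) x
  have h8 := commonPrefix_le_left (c ^ j) (c ^ k * x)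
  rw [isPrefix_iff] at hx ⊢
  rw [norm_inv_pow hc, norm_inv_eq] at *
  rw [← inv_pow] at h2
  rw [hc] at *
  have h9 : 2 * (j * c.norm) ≤ k * c.norm := by nlinarith
  omega

/-- The elements that begin with a large power of `c` or of `c⁻¹`. -/
def powerPrefixed (c : FreeGroup α) (j : ℕ) : Set (FreeGroup α) :=
  {x | IsPrefix (c ^ j) x ∨ IsPrefix (c⁻¹ ^ j) x}

theorem pow_mul_mem_powerPrefixed {c x : FreeGroup α} (hc : ∀ k : ℕ, (c ^ k).norm = k * c.norm)
    {j k : ℕ} (hk : 2 * j ≤ k) (hx : x ∉ powerPrefixed c j) :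
    c ^ k * x ∈ powerPrefixed c j ∧ c⁻¹ ^ k * x ∈ powerPrefixed c j := by
  simp only [powerPrefixed, mem_ofPred_eq, not_or] at hx
  refine ⟨Or.inl (isPrefix_pow_mul hc hk hx.2), Or.inr ?_⟩
  exact isPrefix_pow_mul (norm_inv_pow hc) hk (by rw [inv_inv]; exact hx.1)

theorem notMem_powerPrefixed_of_norm_lt {c x : FreeGroup α}
    (hc : ∀ k : ℕ, (c ^ k).norm = k * c.norm) (h1 : c ≠ 1) {j : ℕ} (hx : x.norm < j) :
    x ∉ powerPrefixed c j := by
  have hn : 0 < c.norm := Nat.pos_of_ne_zero (by simpa using h1)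
  have h2 : j ≤ j * c.norm := Nat.le_mul_of_pos_right _ hn
  rintro (h | h) <;> have h := h.norm_le
  · rw [hc] at h; omega
  · rw [norm_inv_pow hc, norm_inv_eq] at h; omega

theorem conj_eq_of_isPrefix_pow {c₁ c₂ p x : FreeGroup α}
    (hc₁ : ∀ k : ℕ, (c₁ ^ k).norm = k * c₁.norm) (hc₂ : ∀ k : ℕ, (c₂ ^ k).norm = k * c₂.norm)
    (hn : c₁.norm = c₂.norm) (h1 : c₁ ≠ 1) {j : ℕ} (hp : 2 * p.norm + 2 ≤ j)
    (hx : IsPrefix (c₁ ^ j) x) (hpx : IsPrefix (c₂ ^ j) (p * x)) : p * c₁ * p⁻¹ = c₂ := by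
  have hpos : 0 < c₁.norm := Nat.pos_of_ne_zero (by simpa using h1)
  have key : ∀ i, p.norm < i → i ≤ j → IsPrefix (p⁻¹ * c₂ ^ i) x ∧
      (p⁻¹ * c₂ ^ i).norm + (p * x).norm = x.norm + i * c₁.norm := by
    intro i hi hij
    have h2 := (isPrefix_pow_pow hc₂ hij).trans hpx
    have h3 : IsPrefix (p⁻¹ * c₂ ^ i) x := by
      rcases h2.isPrefix_or (p := p) with h | h
      · have := h.norm_le
        rw [hc₂, ← hn] at this
        have := Nat.le_mul_of_pos_right i hpos
        omega
      · rwa [inv_mul_cancel_left] at h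
    refine ⟨h3, ?_⟩
    unfold IsPrefix at h2 h3
    have e : (p⁻¹ * c₂ ^ i)⁻¹ * x = (c₂ ^ i)⁻¹ * (p * x) := by group
    rw [e] at h3
    rw [hc₂, ← hn] at h2
    omega
  obtain ⟨ha, ha'⟩ := key (p.norm + 1) (by omega) (by omega)
  obtain ⟨hb, hb'⟩ := key (p.norm + 2) (by omega) (by omega)
  obtain ⟨k, rfl⟩ : ∃ k, j = k + 1 := ⟨j - 1, by omega⟩
  have h4 : IsPrefix (p⁻¹ * c₂ ^ (p.norm + 1)) (c₁ ^ k) := by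
    refine ha.of_norm_le ((isPrefix_pow_pow hc₁ (Nat.le_succ k)).trans hx) ?_
    have h5 := norm_mul_le p⁻¹ (c₂ ^ (p.norm + 1))
    rw [norm_inv_eq, hc₂, ← hn] at h5
    rw [hc₁]
    have : (2 * p.norm + 1) * c₁.norm ≤ k * c₁.norm := Nat.mul_le_mul_right _ (by omega)
    nlinarith
  obtain ⟨h5, h6⟩ := h4.mul_left_of_pow hc₁
  have h7 := (h5.trans hx).eq_of_norm_eq hb (by
    have : (p.norm + 2) * c₁.norm = (p.norm + 1) * c₁.norm + c₁.norm := by ring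
    omega)
  have e : c₂ ^ (p.norm + 2) = c₂ * c₂ ^ (p.norm + 1) := pow_succ' _ _
  rw [e, ← mul_assoc, ← mul_assoc, mul_left_inj] at h7
  rw [mul_assoc, h7, mul_inv_cancel_left]

theorem mul_notMem_powerPrefixed {c p x : FreeGroup α}
    (hc : ∀ k : ℕ, (c ^ k).norm = k * c.norm) (h1 : c ≠ 1) {j : ℕ} (hj : 2 * p.norm + 2 ≤ j)
    (hp : p * c * p⁻¹ ≠ c) (hp' : p * c * p⁻¹ ≠ c⁻¹) (hx : x ∈ powerPrefixed c j) :
    p * x ∉ powerPrefixed c j := by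
  have hc' := norm_inv_pow hc
  have h1' : c⁻¹ ≠ 1 := inv_ne_one.2 h1
  have e : p * c⁻¹ * p⁻¹ = (p * c * p⁻¹)⁻¹ := by group
  rcases hx with hx | hx <;> rintro (h | h)
  · exact hp (conj_eq_of_isPrefix_pow hc hc rfl h1 hj hx h)
  · exact hp' (conj_eq_of_isPrefix_pow hc hc' norm_inv_eq.symm h1 hj hx h)
  · have := conj_eq_of_isPrefix_pow hc' hc norm_inv_eq h1' hj hx h
    rw [e, inv_eq_iff_eq_inv] at this
    exact hp' this
  · have := conj_eq_of_isPrefix_pow hc' hc' rfl h1' hj hx h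
    rw [e, inv_inj] at this
    exact hp this

end FreeGroup

/-- Elements that are alternating products of syllables from `K true` and `K false` lying outside
the cyclic subgroup generated by `z`; the Boolean records the type of the first syllable, and the
natural number the total length of the syllables. -/
inductive IsAlternatingProduct {G : Type*} [Group G] (K : Bool → ℕ → Set G) (z : G) :
    Bool → ℕ → G → Prop
  | single {s : Bool} {l : ℕ} {x : G} : x ∈ K s l → x ∉ Subgroup.zpowers z →
      IsAlternatingProduct K z s l x
  | cons {s : Bool} {l l' : ℕ} {x g : G} : x ∈ K s l → x ∉ Subgroup.zpowers z →
      IsAlternatingProduct K z (!s) l' g → IsAlternatingProduct K z s (l + l') (x * g)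

namespace IsAlternatingProduct

variable {G : Type*} [Group G] {K : Bool → ℕ → Set G} {z : G}

theorem zpow_mul (hmul : ∀ s l l' x y, x ∈ K s l → y ∈ K s l' → x * y ∈ K s (l + l'))
    {s : Bool} {l m : ℕ} {g y : G} (hy : y ∈ Subgroup.zpowers z) (hym : ∀ s, y ∈ K s m)
    (hg : IsAlternatingProduct K z s l g) : IsAlternatingProduct K z s (m + l) (y * g) := by
  cases hg with
  | single hx hxz =>
    exact single (hmul _ _ _ _ _ (hym _) hx) (by rwa [Subgroup.mul_mem_cancel_left _ hy])
  | cons hx hxz hg =>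
    rw [← add_assoc, ← mul_assoc]
    exact cons (hmul _ _ _ _ _ (hym _) hx) (by rwa [Subgroup.mul_mem_cancel_left _ hy]) hg

theorem exists_of_mem_list (hmul : ∀ s l l' x y, x ∈ K s l → y ∈ K s l' → x * y ∈ K s (l + l'))
    (hz : ∀ s (e : ℤ), z ^ e ∈ K s e.natAbs)
    (hz' : ∀ s l (e : ℤ), z ^ e ∈ K s l → e.natAbs ≤ l)
    (L : List G) (hL : ∀ x ∈ L, ∃ s, x ∈ K s 1) :
    (∃ e : ℤ, L.prod = z ^ e ∧ e.natAbs ≤ L.length) ∨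
      ∃ s, ∃ l ≤ L.length, IsAlternatingProduct K z s l L.prod := by
  induction L with
  | nil => exact Or.inl ⟨0, by simp⟩
  | cons x L ih =>
    obtain ⟨s, hx⟩ := hL x (by simp)
    have ih := ih fun y hy => hL y (by simp [hy])
    rw [List.prod_cons, List.length_cons]
    generalize L.prod = g at *
    generalize L.length = n at *
    by_cases hxz : x ∈ Subgroup.zpowers z
    · obtain ⟨e, rfl⟩ := Subgroup.mem_zpowers_iff.1 hxz
      have he := hz' _ _ _ hx
      rcases ih with ⟨e', rfl, he'⟩ | ⟨t, l, hl, hg⟩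
      · exact Or.inl ⟨e + e', (zpow_add _ _ _).symm, by omega⟩
      · exact Or.inr ⟨t, e.natAbs + l, by omega, hg.zpow_mul hmul hxz fun s => hz s e⟩
    · rcases ih with ⟨e', rfl, he'⟩ | ⟨t, l, hl, hg⟩
      · refine Or.inr ⟨s, 1 + e'.natAbs, by omega, single (hmul _ _ _ _ _ hx (hz s e')) ?_⟩
        rwa [Subgroup.mul_mem_cancel_right _ (Subgroup.zpow_mem_zpowers z e')]
      · by_cases hst : t = !s
        · subst hst
          exact Or.inr ⟨s, 1 + l, by omega, cons hx hxz hg⟩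
        · obtain rfl : t = s := by cases s <;> cases t <;> simp_all
          cases hg with
          | single hy hyz =>
            have hxy := hmul _ _ _ _ _ hx hy
            by_cases h : x * g ∈ Subgroup.zpowers z
            · obtain ⟨e, he⟩ := Subgroup.mem_zpowers_iff.1 h
              rw [← he] at hxy
              have := hz' _ _ _ hxy
              exact Or.inl ⟨e, he.symm, by omega⟩
            · exact Or.inr ⟨t, 1 + l, by omega, single hxy h⟩
          | @cons _ l₁ l₂ y g hy hyz hg =>
            have hxy := hmul _ _ _ _ _ hx hy
            rw [← mul_assoc]
            by_cases h : x * y ∈ Subgroup.zpowers z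
            · obtain ⟨e, he⟩ := Subgroup.mem_zpowers_iff.1 h
              rw [← he] at hxy h ⊢
              have := hz' _ _ _ hxy
              exact Or.inr ⟨!t, e.natAbs + l₂, by omega, hg.zpow_mul hmul h fun s => hz s e⟩
            · exact Or.inr ⟨t, 1 + l₁ + l₂, by omega, cons hxy h hg⟩

open FreeGroup in
theorem map_mem_powerPrefixed_iff {α : Type*} [DecidableEq α] {c : FreeGroup α} (h1 : c ≠ 1)
    (hc : ∀ k : ℕ, (c ^ k).norm = k * c.norm) (Φ : G →* FreeGroup α) {j k M : ℕ} (hk : 2 * j ≤ k)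
    (hΦ : ∀ s l x, l ≤ M → x ∈ K s l → x ∉ Subgroup.zpowers z → ∃ p : FreeGroup α,
      2 * p.norm + 2 ≤ j ∧ p * c * p⁻¹ ≠ c ∧ p * c * p⁻¹ ≠ c⁻¹ ∧
        Φ x = if s then c ^ k * p * c⁻¹ ^ k else p)
    {s : Bool} {l : ℕ} {g : G} (hg : IsAlternatingProduct K z s l g) (hl : l ≤ M) :
    (Φ g ∈ powerPrefixed c j ↔ s = true) ∧ Φ g ≠ 1 := by
  have hone : ∀ j, 0 < j → 1 ∉ powerPrefixed c j := fun j hj =>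
    notMem_powerPrefixed_of_norm_lt hc h1 (by simpa using hj)
  have conj : ∀ p y : FreeGroup α, 2 * p.norm + 2 ≤ j → p * c * p⁻¹ ≠ c → p * c * p⁻¹ ≠ c⁻¹ →
      y ∉ powerPrefixed c j → c ^ k * p * c⁻¹ ^ k * y ∈ powerPrefixed c j := by
    intro p y hp hp1 hp2 hy
    rw [mul_assoc, mul_assoc]
    exact (pow_mul_mem_powerPrefixed hc hk (mul_notMem_powerPrefixed hc h1 hp hp1 hp2
      (pow_mul_mem_powerPrefixed hc hk hy).2)).1
  induction hg with
  | @single s l x hx hxz =>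
    obtain ⟨p, hp, hp1, hp2, hpx⟩ := hΦ _ _ _ hl hx hxz
    cases s
    · simp only [Bool.false_eq_true, if_false] at hpx
      rw [hpx]
      refine ⟨by simpa using notMem_powerPrefixed_of_norm_lt hc h1 (by omega), ?_⟩
      rintro rfl
      simp at hp1
    · simp only [if_true] at hpx
      have h := conj p 1 hp hp1 hp2 (hone j (by omega))
      rw [mul_one, ← hpx] at h
      exact ⟨by simpa using h, fun h' => hone j (by omega) (h' ▸ h)⟩
  | @cons s l l' x g hx hxz hg ih =>
    obtain ⟨p, hp, hp1, hp2, hpx⟩ := hΦ _ _ _ (by omega) hx hxz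
    obtain ⟨ih, -⟩ := ih (by omega)
    rw [MonoidHom.map_mul]
    cases s
    · simp only [Bool.false_eq_true, if_false] at hpx
      rw [hpx]
      have hmem := ih.2 rfl
      refine ⟨by simpa using mul_notMem_powerPrefixed hc h1 hp hp1 hp2 hmem, fun h => ?_⟩
      rw [mul_eq_one_iff_inv_eq] at h
      rw [← h] at hmem
      exact notMem_powerPrefixed_of_norm_lt hc h1 (by rw [norm_inv_eq]; omega) hmem
    · simp only [if_true] at hpx
      have h := conj p (Φ g) hp hp1 hp2 (by simp [ih])
      rw [← hpx] at h
      exact ⟨by simpa using h, fun h' => hone j (by omega) (h' ▸ h)⟩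

end IsAlternatingProduct

namespace FreeGroup

theorem norm_map_le {ι α : Type*} [DecidableEq ι] [DecidableEq α] (φ : FreeGroup ι →* FreeGroup α)
    {B : ℕ} (hB : ∀ i, (φ (of i)).norm ≤ B) (x : FreeGroup ι) : (φ x).norm ≤ x.norm * B := by
  have key : ∀ L : List (ι × Bool), (φ (mk L)).norm ≤ L.length * B := by
    intro L
    induction L with
    | nil => simp [← one_eq_mk]
    | cons p L ih =>
      have e : mk (p :: L) = mk [p] * mk L := by simp [mul_mk]
      rw [e, MonoidHom.map_mul, List.length_cons, add_mul, one_mul, add_comm]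
      refine (norm_mul_le _ _).trans (Nat.add_le_add ?_ ih)
      rcases p with ⟨i, b⟩
      cases b
      · have : mk [(i, false)] = (of i)⁻¹ := by simp [of, inv_mk, invRev]
        rw [this, MonoidHom.map_inv, norm_inv_eq]
        exact hB i
      · exact hB i
  conv_lhs => rw [← mk_toWord (x := x)]
  exact key _

theorem norm_zpow_le {α : Type*} [DecidableEq α] (x : FreeGroup α) {W : ℕ} (hx : x.norm ≤ W)
    (e : ℤ) : (x ^ e).norm ≤ W * e.natAbs := by
  have key : ∀ n : ℕ, (x ^ n).norm ≤ W * n := by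
    intro n
    induction n with
    | zero => simp
    | succ n ih => rw [pow_succ]; exact (norm_mul_le _ _).trans (by rw [mul_add]; omega)
  rcases e.eq_nat_or_neg with ⟨n, rfl | rfl⟩
  · simpa using key n
  · simpa [norm_inv_eq] using key n

/-- A homomorphism from an amalgam of two free groups over a cyclic group that is faithful enough
on the factors has trivial kernel on a large ball once one factor is twisted by a large power of
the amalgamated element. -/
theorem eq_one_of_amalgam_twist {ι κ α G : Type*} [DecidableEq ι] [DecidableEq κ] [DecidableEq α]
    [Group G] {f : FreeGroup ι →* G} {f' : FreeGroup κ →* G} {zA : FreeGroup ι} {zB : FreeGroup κ}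
    (hz : f zA = f' zB) (χ : G →* Multiplicative ℤ) (hχz : (χ (f zA)).toAdd = 2)
    (hχA : ∀ i, (χ (f (of i))).toAdd.natAbs ≤ 2) (hχB : ∀ i, (χ (f' (of i))).toAdd.natAbs ≤ 2)
    (hA : ∀ p, Commute p zA → p ∈ Subgroup.zpowers zA)
    (hB : ∀ p, Commute p zB → p ∈ Subgroup.zpowers zB)
    {W : ℕ} (hW : 1 ≤ W) (hWA : zA.norm ≤ W) (hWB : zB.norm ≤ W)
    {c : FreeGroup α} (h1 : c ≠ 1) (hc : ∀ k : ℕ, (c ^ k).norm = k * c.norm) {m j k D : ℕ}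
    (hk : 2 * j ≤ k) (hj : 2 * (W * m * D) + 2 ≤ j)
    {a : FreeGroup ι →* FreeGroup α} (ha : a zA = c) (haD : ∀ i, (a (of i)).norm ≤ D)
    (haR : ∀ x, x.norm ≤ 2 * (W * m) + 2 * W → a x = 1 → x = 1)
    {b : FreeGroup κ →* FreeGroup α} (hb : b zB = c) (hbD : ∀ i, (b (of i)).norm ≤ D)
    (hb_inj : Function.Injective b) {Φ : G →* FreeGroup α}
    (hΦA : ∀ x, Φ (f x) = c ^ k * a x * c⁻¹ ^ k) (hΦB : ∀ y, Φ (f' y) = b y)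
    {g : G} (hg : g ∈ wordBall (range (fun i => f (of i)) ∪ range fun i => f' (of i)) m)
    (hg1 : Φ g = 1) : g = 1 := by
  let K : Bool → ℕ → Set G := fun s l => {x | (χ x).toAdd.natAbs ≤ 2 * l ∧
    if s then ∃ p, f p = x ∧ p.norm ≤ W * l else ∃ p, f' p = x ∧ p.norm ≤ W * l}
  set z := f zA with hzdef
  have hχpow : ∀ e : ℤ, (χ (z ^ e)).toAdd = e * 2 := by
    intro e
    rw [map_zpow, toAdd_zpow, hχz, smul_eq_mul]
  have hmul : ∀ s l l' x y, x ∈ K s l → y ∈ K s l' → x * y ∈ K s (l + l') := by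
    rintro s l l' x y ⟨hx, hx'⟩ ⟨hy, hy'⟩
    refine ⟨?_, ?_⟩
    · rw [MonoidHom.map_mul, toAdd_mul]; omega
    · cases s
      · simp only [Bool.false_eq_true, if_false] at hx' hy' ⊢
        obtain ⟨p, rfl, hp⟩ := hx'
        obtain ⟨q, rfl, hq⟩ := hy'
        exact ⟨p * q, MonoidHom.map_mul _ _ _, (norm_mul_le p q).trans (by rw [mul_add]; omega)⟩
      · simp only [if_true] at hx' hy' ⊢
        obtain ⟨p, rfl, hp⟩ := hx'
        obtain ⟨q, rfl, hq⟩ := hy'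
        exact ⟨p * q, MonoidHom.map_mul _ _ _, (norm_mul_le p q).trans (by rw [mul_add]; omega)⟩
  have hzK : ∀ s (e : ℤ), z ^ e ∈ K s e.natAbs := by
    intro s e
    refine ⟨by rw [hχpow]; omega, ?_⟩
    cases s
    · simp only [Bool.false_eq_true, if_false]
      exact ⟨zB ^ e, by rw [map_zpow, hz], norm_zpow_le _ hWB e⟩
    · simp only [if_true]
      exact ⟨zA ^ e, by rw [map_zpow], norm_zpow_le _ hWA e⟩
  have hzK' : ∀ s l (e : ℤ), z ^ e ∈ K s l → e.natAbs ≤ l := by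
    rintro s l e ⟨h, -⟩
    rw [hχpow] at h
    omega
  have hsyl : ∀ s l x, l ≤ m → x ∈ K s l → x ∉ Subgroup.zpowers z → ∃ p : FreeGroup α,
      2 * p.norm + 2 ≤ j ∧ p * c * p⁻¹ ≠ c ∧ p * c * p⁻¹ ≠ c⁻¹ ∧
        Φ x = if s then c ^ k * p * c⁻¹ ^ k else p := by
    rintro s l x hl ⟨-, hx⟩ hxz
    have hWl : W * l ≤ W * m := Nat.mul_le_mul_left _ hl
    have hχinv : ∀ y : G, y * z * y⁻¹ ≠ z⁻¹ := by
      intro y h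
      have h := congrArg (fun g => (χ g).toAdd) h
      simp only [MonoidHom.map_mul, MonoidHom.map_inv, toAdd_mul, toAdd_inv, hχz] at h
      omega
    cases s
    · simp only [Bool.false_eq_true, if_false] at hx ⊢
      obtain ⟨p, rfl, hp⟩ := hx
      refine ⟨b p, ?_, ?_, ?_, hΦB p⟩
      · have h2 := norm_map_le b hbD p
        have h3 := Nat.mul_le_mul_right D (hp.trans hWl)
        omega
      · intro h
        rw [← hb, ← MonoidHom.map_inv, ← MonoidHom.map_mul, ← MonoidHom.map_mul] at h
        obtain ⟨e, rfl⟩ := Subgroup.mem_zpowers_iff.1 (hB p (mul_inv_eq_iff_eq_mul.1 (hb_inj h)))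
        exact hxz (by rw [map_zpow, ← hz]; exact Subgroup.zpow_mem_zpowers _ _)
      · intro h
        rw [← hb, ← MonoidHom.map_inv, ← MonoidHom.map_inv, ← MonoidHom.map_mul,
          ← MonoidHom.map_mul] at h
        have h := congrArg f' (hb_inj h)
        rw [MonoidHom.map_mul, MonoidHom.map_mul, MonoidHom.map_inv, MonoidHom.map_inv, ← hz] at h
        exact hχinv _ h
    · simp only [if_true] at hx ⊢
      obtain ⟨p, rfl, hp⟩ := hx
      have hsmall : ∀ y : FreeGroup ι, y.norm ≤ W → (p * zA * p⁻¹ * y).norm ≤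
          2 * (W * m) + 2 * W := by
        intro y hy
        have h2 := norm_mul_le (p * zA * p⁻¹) y
        have h3 := norm_mul_le (p * zA) p⁻¹
        have h4 := norm_mul_le p zA
        rw [norm_inv_eq] at h3
        omega
      refine ⟨a p, ?_, ?_, ?_, hΦA p⟩
      · have h2 := norm_map_le a haD p
        have h3 := Nat.mul_le_mul_right D (hp.trans hWl)
        omega
      · intro h
        rw [← ha, ← MonoidHom.map_inv, ← MonoidHom.map_mul, ← MonoidHom.map_mul,
          ← mul_inv_eq_one, ← MonoidHom.map_inv, ← MonoidHom.map_mul] at h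
        have h := haR _ (hsmall _ (by rwa [norm_inv_eq])) h
        rw [mul_inv_eq_one] at h
        obtain ⟨e, rfl⟩ := Subgroup.mem_zpowers_iff.1 (hA p (mul_inv_eq_iff_eq_mul.1 h))
        exact hxz (by rw [map_zpow]; exact Subgroup.zpow_mem_zpowers _ _)
      · intro h
        rw [← ha, ← MonoidHom.map_inv, ← MonoidHom.map_inv, ← MonoidHom.map_mul,
          ← MonoidHom.map_mul, ← mul_inv_eq_one, ← MonoidHom.map_inv, ← MonoidHom.map_mul,
          inv_inv] at h
        have h := congrArg f (haR _ (hsmall _ hWA) h)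
        rw [MonoidHom.map_mul, MonoidHom.map_mul, MonoidHom.map_mul, MonoidHom.map_one,
          MonoidHom.map_inv, mul_eq_one_iff_eq_inv] at h
        exact hχinv _ h
  obtain ⟨L, hLm, hL, rfl⟩ := hg
  have hgen : ∀ x ∈ (range (fun i => f (of i)) ∪ range fun i => f' (of i)),
      ∃ s, x ∈ K s 1 ∧ x⁻¹ ∈ K s 1 := by
    rintro x (⟨i, rfl⟩ | ⟨i, rfl⟩)
    · refine ⟨true, ⟨by simpa using hχA i, of i, rfl, by simpa using hW⟩, ?_, (of i)⁻¹, ?_, ?_⟩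
      · simpa using hχA i
      · simp
      · simpa using hW
    · refine ⟨false, ⟨by simpa using hχB i, of i, rfl, by simpa using hW⟩, ?_, (of i)⁻¹, ?_, ?_⟩
      · simpa using hχB i
      · simp
      · simpa using hW
  have hLK : ∀ x ∈ L, ∃ s, x ∈ K s 1 := by
    intro x hx
    rcases hL x hx with h | h
    · obtain ⟨s, h, -⟩ := hgen x h
      exact ⟨s, h⟩
    · obtain ⟨s, -, h⟩ := hgen _ h
      exact ⟨s, by rwa [inv_inv] at h⟩
  rcases IsAlternatingProduct.exists_of_mem_list hmul hzK hzK' L hLK with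
    ⟨e, he, -⟩ | ⟨s, l, hl, h⟩
  · rw [he, map_zpow, hz, hΦB, hb, IsMulTorsionFree.zpow_eq_one_iff_right h1] at hg1
    rw [he, hg1, zpow_zero]
  · exact absurd hg1 (h.map_mem_powerPrefixed_iff h1 hc Φ hk hsyl (hl.trans hLm)).2

end FreeGroup

namespace FreeGroup

theorem mem_wordBall_of_norm_le {ι G : Type*} [DecidableEq ι] [Group G] (f : FreeGroup ι →* G)
    {Y : Set G} (hY : ∀ i, f (of i) ∈ Y ∨ (f (of i))⁻¹ ∈ Y) {x : FreeGroup ι} {m : ℕ}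
    (hx : x.norm ≤ m) : f x ∈ wordBall Y m := by
  refine ⟨x.toWord.map fun p => f (mk [p]), by simpa [norm] using hx, ?_, ?_⟩
  · intro y hy
    obtain ⟨⟨i, b⟩, -, rfl⟩ := List.mem_map.1 hy
    cases b
    · have : (mk [(i, false)] : FreeGroup ι) = (of i)⁻¹ := by simp [of, inv_mk, invRev]
      rw [this, MonoidHom.map_inv, inv_inv]
      exact (hY i).symm
    · exact hY i
  · have key : ∀ L : List (ι × Bool), (L.map fun p => f (mk [p])).prod = f (mk L) := by
      intro L
      induction L with
      | nil => simp [← one_eq_mk]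
      | cons p L ih =>
        rw [List.map_cons, List.prod_cons, ih, ← MonoidHom.map_mul, mul_mk]
        rfl
    rw [key, mk_toWord]

theorem map_eq_conj_of_forall {ι G H : Type*} [Group G] [Group H] {f : FreeGroup ι →* G}
    {a : FreeGroup ι →* H} {Φ : G →* H} {c : H} {k : ℕ}
    (h : ∀ i, Φ (f (of i)) = c ^ k * a (of i) * c⁻¹ ^ k) (x : FreeGroup ι) :
    Φ (f x) = c ^ k * a x * c⁻¹ ^ k := by
  have : Φ.comp f = (MulAut.conj (c ^ k)).toMonoidHom.comp a := by
    ext i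
    change Φ (f (of i)) = c ^ k * a (of i) * (c ^ k)⁻¹
    rw [h, inv_pow]
  rw [inv_pow]
  exact DFunLike.congr_fun this x

/-- Polynomial approximations of a free group with prescribed value at `zA` extend to an amalgam
along `zA` with a free group that embeds. -/
theorem exists_polynomial_of_amalgam {ι κ α G : Type*} [DecidableEq ι] [DecidableEq κ] [Finite κ]
    [DecidableEq α]
    [Group G] {f : FreeGroup ι →* G} {f' : FreeGroup κ →* G} {zA : FreeGroup ι} {zB : FreeGroup κ}
    (hz : f zA = f' zB) (χ : G →* Multiplicative ℤ) (hχz : (χ (f zA)).toAdd = 2)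
    (hχA : ∀ i, (χ (f (of i))).toAdd.natAbs ≤ 2) (hχB : ∀ i, (χ (f' (of i))).toAdd.natAbs ≤ 2)
    (hA : ∀ p, Commute p zA → p ∈ Subgroup.zpowers zA)
    (hB : ∀ p, Commute p zB → p ∈ Subgroup.zpowers zB)
    {c : FreeGroup α} (h1 : c ≠ 1) (hc : ∀ k : ℕ, (c ^ k).norm = k * c.norm)
    {b : FreeGroup κ →* FreeGroup α} (hb : b zB = c) (hb_inj : Function.Injective b)
    (hΦ : ∀ (a : FreeGroup ι →* FreeGroup α) (k : ℕ), a zA = c → ∃ Φ : G →* FreeGroup α,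
      (∀ i, Φ (f (of i)) = c ^ k * a (of i) * c⁻¹ ^ k) ∧ ∀ i, Φ (f' (of i)) = b (of i))
    (ha : ∃ P : Polynomial ℕ, ∀ m : ℕ, ∃ a : FreeGroup ι →* FreeGroup α, a zA = c ∧
      (∀ i, (a (of i)).norm ≤ P.eval m) ∧ ∀ x, x.norm ≤ m → a x = 1 → x = 1) :
    ∃ P : Polynomial ℕ, ∀ m : ℕ, ∃ Φ : G →* FreeGroup α, (∀ y, Φ (f' y) = b y) ∧
      (∀ i, (Φ (f (of i))).norm ≤ P.eval m) ∧ (∀ i, (Φ (f' (of i))).norm ≤ P.eval m) ∧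
      ∀ x ∈ wordBall (range (fun i => f (of i)) ∪ range fun i => f' (of i)) m,
        Φ x = 1 → x = 1 := by
  obtain ⟨P, hP⟩ := ha
  obtain ⟨Cb, hCb⟩ : ∃ Cb, ∀ i, (b (of i)).norm ≤ Cb := by
    cases nonempty_fintype κ
    exact ⟨_, fun i => Finset.le_sup (f := fun i => (b (of i)).norm) (Finset.mem_univ i)⟩
  let W := zA.norm + zB.norm + 1
  let D : Polynomial ℕ := P.comp (.C (2 * W) * .X + .C (2 * W)) + .C Cb
  let J : Polynomial ℕ := .C (2 * W) * .X * D + .C 2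
  refine ⟨.C (4 * c.norm) * J + D, fun m => ?_⟩
  have hD : D.eval m = P.eval (2 * W * m + 2 * W) + Cb := by simp [D]
  have hJ : J.eval m = 2 * (W * m * D.eval m) + 2 := by simp [J]; ring
  obtain ⟨a, haz, haP, ha⟩ := hP (2 * W * m + 2 * W)
  have haD : ∀ i, (a (of i)).norm ≤ D.eval m := fun i => (haP i).trans (by rw [hD]; simp)
  have hbD : ∀ i, (b (of i)).norm ≤ D.eval m := fun i => (hCb i).trans (by omega)
  obtain ⟨Φ, hΦA, hΦB⟩ := hΦ a (2 * J.eval m) haz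
  have hΦA' : ∀ x, Φ (f x) = c ^ (2 * J.eval m) * a x * c⁻¹ ^ (2 * J.eval m) :=
    map_eq_conj_of_forall hΦA
  have hΦB' : ∀ x, Φ (f' x) = b x := by
    intro x
    have : Φ.comp f' = b := by
      ext i
      simp [hΦB]
    exact DFunLike.congr_fun this x
  have hev : (.C (4 * c.norm) * J + D : Polynomial ℕ).eval m =
      4 * c.norm * J.eval m + D.eval m := by simp
  refine ⟨Φ, hΦB', fun i => ?_, fun i => ?_, fun g hg hg1 => ?_⟩
  · rw [hΦA, hev]
    have h2 := norm_mul_le (c ^ (2 * J.eval m) * a (of i)) (c⁻¹ ^ (2 * J.eval m))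
    have h3 := norm_mul_le (c ^ (2 * J.eval m)) (a (of i))
    rw [norm_inv_pow hc, norm_inv_eq] at h2
    rw [hc] at h3
    have h4 := haD i
    linarith
  · rw [hΦB, hev]
    exact (hbD i).trans (Nat.le_add_left _ _)
  · exact eq_one_of_amalgam_twist (W := W) hz χ hχz hχA hχB hA hB (by omega) (by omega) (by omega)
      h1 hc le_rfl hJ.ge haz haD (fun x hx => ha x (by rw [← mul_assoc] at hx; exact hx)) hb hbD
      hb_inj hΦA' hΦB' hg hg1

end FreeGroup

theorem nonorientableSurfaceRelator_succ (n : ℕ) : nonorientableSurfaceRelator (n + 1) =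
    FreeGroup.map Fin.castSucc (nonorientableSurfaceRelator n) *
      FreeGroup.of (Fin.last n) ^ 2 := by
  rw [nonorientableSurfaceRelator, List.ofFn_succ', List.concat_eq_append, List.prod_append,
    nonorientableSurfaceRelator, map_list_prod, List.map_ofFn]
  simp [Function.comp_def]

theorem nonorientableSurfaceRelator_two : nonorientableSurfaceRelator 2 =
    FreeGroup.of 0 ^ 2 * FreeGroup.of 1 ^ 2 := by
  simp [nonorientableSurfaceRelator]

theorem lift_nonorientableSurfaceRelator_eq_sq {M : Type*} [Group M] {n : ℕ}
    (t : Fin (n + 1) → M) (ht : ∀ i, i ≠ 0 → t i = 1) :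
    FreeGroup.lift t (nonorientableSurfaceRelator (n + 1)) = t 0 ^ 2 := by
  rw [nonorientableSurfaceRelator, map_list_prod, List.map_ofFn, List.ofFn_succ, List.prod_cons,
    List.prod_eq_one]
  · simp
  · intro x hx
    obtain ⟨i, rfl⟩ := (List.mem_ofFn' _ _).1 hx
    simp [ht i.succ (Fin.succ_ne_zero i)]

theorem mem_zpowers_of_commute_nonorientableSurfaceRelator {n : ℕ} (p : FreeGroup (Fin (n + 2)))
    (hp : Commute p (nonorientableSurfaceRelator (n + 2))) :
    p ∈ Subgroup.zpowers (nonorientableSurfaceRelator (n + 2)) := by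
  have hpos : ∀ (k : ℕ) (t : Fin k → Fin (n + 2)),
      (List.ofFn fun i => FreeGroup.of (t i) ^ 2).prod =
        FreeGroup.positive (List.ofFn fun i => [t i, t i]).flatten := by
    intro k t
    induction k with
    | zero => rfl
    | succ k ih =>
      rw [List.ofFn_succ, List.ofFn_succ, List.prod_cons, List.flatten_cons,
        FreeGroup.positive_append, ih]
      rfl
  let R : List (Fin (n + 2)) := (List.ofFn fun i : Fin (n + 1) => [i.succ, i.succ]).flatten
  have hR : (0 : Fin (n + 2)) ∉ R := by
    simp only [R, List.mem_flatten, not_exists, not_and]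
    intro l hl
    obtain ⟨i, rfl⟩ := (List.mem_ofFn' _ _).1 hl
    simp [(Fin.succ_ne_zero i).symm]
  have hR' : R ≠ [] := by simp [R, List.ofFn_succ]
  have hrel : nonorientableSurfaceRelator (n + 2) = FreeGroup.positive (0 :: 0 :: R) := by
    refine (hpos _ id).trans ?_
    rw [List.ofFn_succ]
    rfl
  rw [hrel] at hp ⊢
  have hcons : ∀ P Q : List (Fin (n + 2)), 0 :: P ++ 0 :: Q = 0 :: 0 :: R → P = [] := by
    intro P Q h
    rcases P with _ | ⟨x, P⟩
    · rfl
    · simp only [List.cons_append, List.cons.injEq, true_and] at h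
      exact absurd (h.2 ▸ by simp) hR
  refine FreeGroup.mem_zpowers_of_commute_positive _ ?_ (by simp) p hp
  intro P Q hPQ hQP
  rcases P with _ | ⟨x, P⟩
  · exact Or.inl rfl
  rcases Q with _ | ⟨y, Q⟩
  · exact Or.inr rfl
  obtain rfl : x = 0 := by simp_all
  obtain rfl : y = 0 := by simp_all
  rw [hcons P Q hPQ, hcons Q P hQP] at hPQ
  simp only [List.cons_append, List.nil_append, List.cons.injEq, true_and] at hPQ
  exact absurd hPQ.symm hR'

namespace FreeGroup

theorem positive_replicate {α : Type*} (x : α) (k : ℕ) :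
    positive (List.replicate k x) = of x ^ k := by
  induction k with
  | zero => rfl
  | succ k ih =>
    rw [pow_succ', ← ih, List.replicate_succ, ← List.singleton_append, positive_append]; rfl

/-- The positive word `a b²ᵉ a`. -/
def palindrome (e : ℕ) : FreeGroup (Fin 2) := of 0 * of 1 ^ (2 * e) * of 0

theorem palindrome_eq_positive (e : ℕ) :
    palindrome e = positive (0 :: (List.replicate (2 * e) 1 ++ [0])) := by
  rw [← List.singleton_append, positive_append, positive_append, positive_replicate, palindrome,
    mul_assoc]
  rfl

theorem norm_palindrome_pow (e k : ℕ) : (palindrome e ^ k).norm = k * (palindrome e).norm := by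
  rw [palindrome_eq_positive, norm_positive_pow]

theorem palindrome_ne_one (e : ℕ) : palindrome e ≠ 1 := by
  intro h
  have h := congrArg norm h
  rw [palindrome_eq_positive, norm_positive] at h
  simp at h

/-- The homomorphism fixing the first generator and sending the second one to `a⁻¹ bᵉ a`. -/
def conjSubst (e : ℕ) : FreeGroup (Fin 2) →* FreeGroup (Fin 2) :=
  lift ![of 0, (of 0)⁻¹ * of 1 ^ e * of 0]

theorem conjSubst_relator (e : ℕ) :
    conjSubst e (nonorientableSurfaceRelator 2) = palindrome e := by
  rw [nonorientableSurfaceRelator_two]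
  simp [conjSubst, palindrome, pow_two, two_mul, pow_add, mul_assoc]

theorem injective_conjSubst {e : ℕ} (he : 1 ≤ e) : Function.Injective (conjSubst e) := by
  have h := injective_lift_positive (β := Fin 2)
    (fun i : Fin 2 => if i = 0 then [0] else List.replicate e 1)
    (by intro i; fin_cases i <;> simp; omega)
    (by
      intro i j
      obtain ⟨k, rfl⟩ : ∃ k, e = k + 1 := ⟨e - 1, by omega⟩
      fin_cases i <;> fin_cases j <;> simp [List.replicate_succ])
    (by
      intro i j
      obtain ⟨k, rfl⟩ : ∃ k, e = k + 1 := ⟨e - 1, by omega⟩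
      fin_cases i <;> fin_cases j <;> simp [List.replicate_succ'])
  have e : conjSubst e = (MulAut.conj (of 0 : FreeGroup (Fin 2))⁻¹).toMonoidHom.comp
      (lift fun i : Fin 2 => positive (if i = 0 then [0] else List.replicate e 1)) := by
    ext i
    fin_cases i
    · simp [conjSubst, show positive [(0 : Fin 2)] = of 0 from rfl]
    · simp [conjSubst, positive_replicate]
  rw [e]
  exact (MulAut.conj _).injective.comp h

end FreeGroup

namespace FreeGroup

/-- The automorphism used to restore the shape of the image of the relator. -/
theorem exists_injective_map_palindrome (e : ℕ) :
    ∃ σ : FreeGroup (Fin 2) →* FreeGroup (Fin 2), Function.Injective σ ∧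
      σ (palindrome e * ((of 1 ^ e)⁻¹) ^ 2) = palindrome (2 * e) := by
  let σ : FreeGroup (Fin 2) →* FreeGroup (Fin 2) :=
    lift ![of 1 ^ (2 * e) * of 0, (of 0)⁻¹ * (of 1)⁻¹ * of 0]
  let ρ : FreeGroup (Fin 2) →* FreeGroup (Fin 2) :=
    lift ![of 0 * of 1 ^ (2 * e), of 0 * (of 1)⁻¹ * (of 0)⁻¹]
  have hconj : ∀ (x y : FreeGroup (Fin 2)) (k : ℕ), (x * y⁻¹ * x⁻¹) ^ k = x * (y ^ k)⁻¹ * x⁻¹ := by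
    intro x y k
    rw [conj_pow, inv_pow]
  have hconj' : ∀ (x y : FreeGroup (Fin 2)) (k : ℕ), (x⁻¹ * y⁻¹ * x) ^ k = x⁻¹ * (y ^ k)⁻¹ * x := by
    intro x y k
    simpa using hconj x⁻¹ y k
  refine ⟨σ, ?_, ?_⟩
  · have : ρ.comp σ = MonoidHom.id _ := by
      ext i
      fin_cases i
      · simp [σ, ρ, hconj]
      · simp [σ, ρ]
        group
    exact Function.LeftInverse.injective (g := ρ) fun x => DFunLike.congr_fun this x
  · have h0 : σ (of 0) = of 1 ^ (2 * e) * of 0 := by simp [σ]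
    have h1 : σ (of 1) = (of 0)⁻¹ * (of 1)⁻¹ * of 0 := by simp [σ]
    rw [inv_pow, ← pow_mul, mul_comm e 2, palindrome]
    simp only [MonoidHom.map_mul, MonoidHom.map_inv, MonoidHom.map_pow, h0, h1, hconj']
    rw [palindrome, mul_comm 2 (2 * e), pow_mul]
    group

theorem exists_polynomial_freeGroup (n : ℕ) : ∃ e ≥ 1, ∃ P : Polynomial ℕ, ∀ m : ℕ,
    ∃ φ : FreeGroup (Fin (n + 2)) →* FreeGroup (Fin 2),
      φ (nonorientableSurfaceRelator (n + 2)) = palindrome e ∧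
      (∀ i, (φ (of i)).norm ≤ P.eval m) ∧ ∀ x, x.norm ≤ m → φ x = 1 → x = 1 := by
  induction n with
  | zero =>
    refine ⟨1, le_rfl, .C ((conjSubst 1 (of 0)).norm + (conjSubst 1 (of 1)).norm), fun m =>
      ⟨conjSubst 1, conjSubst_relator 1, fun i => ?_, fun x _ hx => ?_⟩⟩
    · fin_cases i <;> simp
    · exact injective_conjSubst le_rfl (hx.trans (MonoidHom.map_one _).symm)
  | succ n ih =>
    obtain ⟨e, he, hP⟩ := ih
    set w := nonorientableSurfaceRelator (n + 2) with hw
    obtain ⟨σ, hσ, hσw⟩ := exists_injective_map_palindrome e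
    let f : FreeGroup (Fin (n + 2)) →* FreeGroup (Fin (n + 3)) := map Fin.castSucc
    let f' : FreeGroup (Fin 2) →* FreeGroup (Fin (n + 3)) := lift ![f w, (of (Fin.last _))⁻¹]
    let χ : FreeGroup (Fin (n + 3)) →* Multiplicative ℤ :=
      lift fun i => if i = 0 then Multiplicative.ofAdd 1 else 1
    have hz : f w = f' (of 0) := by simp [f']
    have hχz : (χ (f w)).toAdd = 2 := by
      have : χ.comp f = lift fun i => if i = 0 then Multiplicative.ofAdd 1 else 1 := by
        ext i
        simp [χ, f, Fin.castSucc_eq_zero_iff]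
      have h2 := lift_nonorientableSurfaceRelator_eq_sq
        (fun i : Fin (n + 2) => if i = 0 then Multiplicative.ofAdd (1 : ℤ) else 1) (by simp_all)
      rw [← this] at h2
      rw [show χ (f w) = _ from h2]
      rfl
    let b : FreeGroup (Fin 2) →* FreeGroup (Fin 2) := lift ![palindrome e, of 1 ^ e]
    have hb : Function.Injective b := by
      have h := injective_lift_positive (β := Fin 2)
        (fun i : Fin 2 => if i = 0 then 0 :: (List.replicate (2 * e) 1 ++ [0])
          else List.replicate e 1)
        (by intro i; fin_cases i <;> simp; omega)
        (by
          intro i j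
          obtain ⟨k, rfl⟩ : ∃ k, e = k + 1 := ⟨e - 1, by omega⟩
          fin_cases i <;> fin_cases j <;> simp [List.replicate_succ])
        (by
          intro i j
          obtain ⟨k, rfl⟩ : ∃ k, e = k + 1 := ⟨e - 1, by omega⟩
          fin_cases i <;> fin_cases j <;> simp [List.replicate_succ', List.getLast?_cons])
      convert h using 2
      ext i
      fin_cases i
      · simp [b, palindrome_eq_positive]
      · simp [b, positive_replicate]
    have hχA : ∀ i, (χ (f (of i))).toAdd.natAbs ≤ 2 := by
      intro i
      simp only [χ, f, map.of, lift_apply_of]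
      split_ifs <;> simp
    have hχB : ∀ i, (χ (f' (of i))).toAdd.natAbs ≤ 2 := by
      intro i
      fin_cases i
      · change (χ (f' (of 0))).toAdd.natAbs ≤ 2
        rw [← hz, hχz]
        rfl
      · simp [f', χ]
    obtain ⟨P, hP⟩ := exists_polynomial_of_amalgam (zA := w) (zB := of 0) hz χ hχz hχA hχB
      mem_zpowers_of_commute_nonorientableSurfaceRelator
      (by
        intro p hp
        refine mem_zpowers_of_commute_positive [0] ?_ (by simp) p hp
        intro P Q h _
        rcases List.append_eq_singleton_iff.1 h with h | h
        · exact Or.inl h.1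
        · exact Or.inr h.2)
      (palindrome_ne_one e) (norm_palindrome_pow e) (b := b) (by simp [b]) hb
      (by
        intro a k ha
        let Φ : FreeGroup (Fin (n + 3)) →* FreeGroup (Fin 2) :=
          lift fun i => Fin.lastCases (motive := fun _ => FreeGroup (Fin 2))
            (of 1 ^ e)⁻¹ (fun i => palindrome e ^ k * a (of i) * (palindrome e)⁻¹ ^ k) i
        have hΦ : ∀ i, Φ (f (of i)) = palindrome e ^ k * a (of i) * (palindrome e)⁻¹ ^ k := by
          intro i
          simp [f, Φ]
        refine ⟨Φ, hΦ, ?_⟩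
        · intro i
          fin_cases i
          · change Φ (f' (of 0)) = b (of 0)
            rw [← hz, map_eq_conj_of_forall hΦ, ha]
            rw [inv_pow, ← pow_succ, pow_succ', mul_inv_cancel_right]
            simp [b]
          · simp [f', b, Φ])
      hP
    refine ⟨2 * e, by omega, P * .C ((σ (of 0)).norm + (σ (of 1)).norm), fun m => ?_⟩
    obtain ⟨Φ, hΦB, hPA, hPB, hker⟩ := hP m
    have hlast : Φ (of (Fin.last (n + 2))) = (of 1 ^ e)⁻¹ := by
      have := hΦB (of 1)
      simp only [f', b, lift_apply_of, Matrix.cons_val_one, Matrix.cons_val_fin_one,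
        MonoidHom.map_inv] at this
      rw [← this, inv_inv]
    refine ⟨σ.comp Φ, ?_, fun i => ?_, fun x hx hx1 => ?_⟩
    · rw [nonorientableSurfaceRelator_succ, ← hw, ← hσw, MonoidHom.comp_apply, MonoidHom.map_mul,
        MonoidHom.map_pow, hlast]
      have := hΦB (of 0)
      rw [← hz] at this
      rw [show Φ (map Fin.castSucc w) = b (of 0) from this]
      simp [b]
    · have h1 := norm_map_le σ (B := (σ (of 0)).norm + (σ (of 1)).norm)
        (by intro i; fin_cases i <;> simp) (Φ (of i))
      refine h1.trans ?_
      rw [Polynomial.eval_mul, Polynomial.eval_C]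
      refine Nat.mul_le_mul_right _ ?_
      induction i using Fin.lastCases with
      | last =>
        have := hPB 1
        simpa [f', norm_inv_eq] using this
      | cast i => simpa [f] using hPA i
    · refine hker x ?_ (hσ (hx1.trans (MonoidHom.map_one _).symm))
      refine mem_wordBall_of_norm_le (MonoidHom.id _) ?_ hx
      intro i
      induction i using Fin.lastCases with
      | last => exact Or.inr (Or.inr ⟨1, by simp [f']⟩)
      | cast i => exact Or.inl (Or.inl ⟨i, by simp [f]⟩)

end FreeGroup

namespace NonorientableSurfaceGroup

/-- The standard generators. -/
def of {g : ℕ} (i : Fin g) : NonorientableSurfaceGroup g :=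
  PresentedGroup.of (rels := {nonorientableSurfaceRelator g}) i

/-- The homomorphism determined by a solution of the defining equation. -/
def lift {g : ℕ} {H : Type*} [Group H] (t : Fin g → H)
    (ht : FreeGroup.lift t (nonorientableSurfaceRelator g) = 1) :
    NonorientableSurfaceGroup g →* H :=
  PresentedGroup.toGroup (rels := {nonorientableSurfaceRelator g}) (f := t)
    (by rintro r rfl; exact ht)

@[simp]
theorem lift_of {g : ℕ} {H : Type*} [Group H] (t : Fin g → H)
    (ht : FreeGroup.lift t (nonorientableSurfaceRelator g) = 1) (i : Fin g) :
    lift t ht (of i) = t i :=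
  PresentedGroup.toGroup.of _

theorem lift_of_relator (g : ℕ) :
    FreeGroup.lift (of (g := g)) (nonorientableSurfaceRelator g) = 1 := by
  have h : FreeGroup.lift (of (g := g)) = PresentedGroup.mk {nonorientableSurfaceRelator g} := by
    ext i
    simp
    rfl
  rw [h]
  exact PresentedGroup.one_of_mem rfl

theorem closure_range_of (g : ℕ) : Subgroup.closure (range (of (g := g))) = ⊤ :=
  PresentedGroup.closure_range_of {nonorientableSurfaceRelator g}

end NonorientableSurfaceGroup

theorem lift_nonorientableSurfaceRelator_add_two {M : Type*} [Group M] {n : ℕ}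
    (t : Fin (n + 2) → M) : FreeGroup.lift t (nonorientableSurfaceRelator (n + 2)) =
      FreeGroup.lift (fun i : Fin n => t i.castSucc.castSucc) (nonorientableSurfaceRelator n) *
        t (Fin.last n).castSucc ^ 2 * t (Fin.last (n + 1)) ^ 2 := by
  have : FreeGroup.lift (fun i : Fin n => t i.castSucc.castSucc) =
      ((FreeGroup.lift t).comp (FreeGroup.map Fin.castSucc)).comp (FreeGroup.map Fin.castSucc) := by
    ext i
    simp
  rw [this, nonorientableSurfaceRelator_succ, nonorientableSurfaceRelator_succ]
  simp

namespace NonorientableSurfaceGroup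

open FreeGroup (palindrome conjSubst)

/-- Nonorientable surface groups of genus at least four are residually free in a strong,
polynomial sense. -/
theorem exists_polynomial (n : ℕ) : ∃ P : Polynomial ℕ, ∀ m : ℕ,
    ∃ Φ : NonorientableSurfaceGroup (n + 4) →* FreeGroup (Fin 2),
      (∀ i, (Φ (of i)).norm ≤ P.eval m) ∧ ∀ x ∈ wordBall (range of) m, Φ x = 1 → x = 1 := by
  obtain ⟨e, he, hP⟩ := FreeGroup.exists_polynomial_freeGroup n
  set w := nonorientableSurfaceRelator (n + 2) with hw
  set u : Fin (n + 4) := Fin.last _ with hu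
  set v : Fin (n + 4) := (Fin.last (n + 2)).castSucc with hv
  let f : FreeGroup (Fin (n + 2)) →* NonorientableSurfaceGroup (n + 4) :=
    FreeGroup.lift fun i => of i.castSucc.castSucc
  let f' : FreeGroup (Fin 2) →* NonorientableSurfaceGroup (n + 4) :=
    FreeGroup.lift ![(of u)⁻¹, (of v)⁻¹]
  have hz : f w = f' (nonorientableSurfaceRelator 2) := by
    have h := lift_of_relator (n + 4)
    rw [lift_nonorientableSurfaceRelator_add_two, mul_assoc, mul_eq_one_iff_eq_inv] at h
    rw [show f w = _ from h, nonorientableSurfaceRelator_two]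
    simp [f', ← hu, ← hv]
  have hlift : FreeGroup.lift (fun i : Fin (n + 2) => if i = 0 then Multiplicative.ofAdd (1 : ℤ)
      else 1) w = Multiplicative.ofAdd 1 ^ 2 :=
    lift_nonorientableSurfaceRelator_eq_sq
      (fun i : Fin (n + 2) => if i = 0 then Multiplicative.ofAdd (1 : ℤ) else 1) (by simp_all)
  have hvu : v ≠ u := (Fin.castSucc_lt_last _).ne
  have hu0 : u ≠ 0 := Fin.last_pos.ne'
  have hv0 : v ≠ 0 := by simp [hv, Fin.castSucc_eq_zero_iff]
  let t : Fin (n + 4) → Multiplicative ℤ := fun i =>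
    if i = 0 then Multiplicative.ofAdd 1 else if i = u then Multiplicative.ofAdd (-1) else 1
  have ht : ∀ i : Fin (n + 2), t i.castSucc.castSucc =
      if i = 0 then Multiplicative.ofAdd (1 : ℤ) else 1 := by
    intro i
    simp [t, Fin.castSucc_eq_zero_iff, hu, (Fin.castSucc_lt_last _).ne]
  let χ : NonorientableSurfaceGroup (n + 4) →* Multiplicative ℤ := lift t (by
    rw [lift_nonorientableSurfaceRelator_add_two, ← hw]
    simp only [ht]
    rw [hlift, ← hu, ← hv]
    simp only [t, hu0, hv0, hvu, if_true, if_false]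
    rfl)
  have hχz : (χ (f w)).toAdd = 2 := by
    have : χ.comp f = FreeGroup.lift fun i => if i = 0 then Multiplicative.ofAdd 1 else 1 := by
      ext i
      simp [χ, f, ht]
    rw [← this] at hlift
    rw [show χ (f w) = _ from hlift]
    rfl
  have hχt : ∀ i, (χ (of i)).toAdd.natAbs ≤ 2 := by
    intro i
    simp only [χ, t, lift_of]
    split_ifs <;> simp
  obtain ⟨P, hP⟩ := FreeGroup.exists_polynomial_of_amalgam hz χ hχz
    (by intro i; simpa [f] using hχt _)
    (by intro i; fin_cases i <;> simpa [f'] using hχt _)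
    mem_zpowers_of_commute_nonorientableSurfaceRelator
    mem_zpowers_of_commute_nonorientableSurfaceRelator
    (FreeGroup.palindrome_ne_one e) (FreeGroup.norm_palindrome_pow e)
    (FreeGroup.conjSubst_relator e) (FreeGroup.injective_conjSubst he)
    (by
      intro a k ha
      let s : Fin (n + 4) → FreeGroup (Fin 2) := fun i =>
        Fin.lastCases (motive := fun _ => FreeGroup (Fin 2)) (conjSubst e (.of 0))⁻¹
          (fun i => Fin.lastCases (motive := fun _ => FreeGroup (Fin 2))
            (conjSubst e (.of 1))⁻¹
            (fun i => palindrome e ^ k * a (.of i) * (palindrome e)⁻¹ ^ k) i) i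
      have hsu : s u = (conjSubst e (.of 0))⁻¹ := by simp [s, hu]
      have hsv : s v = (conjSubst e (.of 1))⁻¹ := by simp [s, hv]
      have hs : ∀ i : Fin (n + 2), s i.castSucc.castSucc =
          palindrome e ^ k * a (.of i) * (palindrome e)⁻¹ ^ k := by
        intro i
        simp [s]
      have hrel : FreeGroup.lift s (nonorientableSurfaceRelator (n + 4)) = 1 := by
        have h := FreeGroup.map_eq_conj_of_forall (f := MonoidHom.id _) (a := a)
          (Φ := FreeGroup.lift fun i => s i.castSucc.castSucc) (c := palindrome e) (k := k)
          (by intro i; simp [hs]) w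
        rw [ha, inv_pow, ← pow_succ, pow_succ', mul_inv_cancel_right] at h
        rw [lift_nonorientableSurfaceRelator_add_two, ← hw]
        rw [show FreeGroup.lift (fun i => s i.castSucc.castSucc) w = _ from h, ← hu, ← hv, hsu, hsv,
          ← FreeGroup.conjSubst_relator e, nonorientableSurfaceRelator_two]
        simp [mul_assoc]
      refine ⟨lift s hrel, fun i => by simp [f, hs], fun i => ?_⟩
      fin_cases i <;> simp [f', hsu, hsv])
    hP
  refine ⟨P, fun m => ?_⟩
  obtain ⟨Φ, -, hPA, hPB, hker⟩ := hP m
  refine ⟨Φ, fun i => ?_, fun x hx => hker x ?_⟩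
  · induction i using Fin.lastCases with
    | last => simpa [f', FreeGroup.norm_inv_eq] using hPB 0
    | cast i =>
      induction i using Fin.lastCases with
      | last => simpa [f', FreeGroup.norm_inv_eq] using hPB 1
      | cast i => simpa [f] using hPA i
  · have key : ∀ i, of i ∈ (range (fun i => f (.of i)) ∪ range fun i => f' (.of i)) ∨
        (of i)⁻¹ ∈ (range (fun i => f (.of i)) ∪ range fun i => f' (.of i)) := by
      intro i
      induction i using Fin.lastCases with
      | last => exact Or.inr (Or.inr ⟨0, by simp [f', hu]⟩)
      | cast i =>
        induction i using Fin.lastCases with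
        | last => exact Or.inr (Or.inr ⟨1, by simp [f', hv]⟩)
        | cast i => exact Or.inl (Or.inl ⟨i, by simp [f]⟩)
    obtain ⟨L, hLm, hL, rfl⟩ := hx
    refine ⟨L, hLm, fun y hy => ?_, rfl⟩
    rcases hL y hy with ⟨i, hi⟩ | ⟨i, hi⟩
    · rw [← hi]
      exact key i
    · rw [inv_eq_iff_eq_inv.1 hi.symm, inv_inv]
      exact (key i).symm

end NonorientableSurfaceGroup

section WordBall

variable {G : Type*} [Group G] {S : Set G}

theorem one_mem_wordBall (S : Set G) (m : ℕ) : (1 : G) ∈ wordBall S m :=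
  ⟨[], by simp, by simp, rfl⟩

theorem wordBall_mono {m m' : ℕ} (h : m ≤ m') : wordBall S m ⊆ wordBall S m' := by
  rintro _ ⟨l, hl, hS, rfl⟩
  exact ⟨l, hl.trans h, hS, rfl⟩

theorem mul_mem_wordBall {m m' : ℕ} {x y : G} (hx : x ∈ wordBall S m) (hy : y ∈ wordBall S m') :
    x * y ∈ wordBall S (m + m') := by
  obtain ⟨l, hl, hS, rfl⟩ := hx
  obtain ⟨l', hl', hS', rfl⟩ := hy
  refine ⟨l ++ l', by simp; omega, fun x hx => ?_, List.prod_append⟩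
  rcases List.mem_append.1 hx with h | h
  exacts [hS x h, hS' x h]

theorem inv_mem_wordBall {m : ℕ} {x : G} (hx : x ∈ wordBall S m) : x⁻¹ ∈ wordBall S m := by
  obtain ⟨l, hl, hS, rfl⟩ := hx
  refine ⟨(l.map fun x => x⁻¹).reverse, by simpa using hl, fun x hx => ?_,
    (List.prod_inv_reverse l).symm⟩
  rw [List.mem_reverse, List.mem_map] at hx
  obtain ⟨y, hy, rfl⟩ := hx
  rw [inv_inv]
  exact (hS y hy).symm

theorem list_prod_mem_wordBall {k : ℕ} {l : List G} (hl : ∀ x ∈ l, x ∈ wordBall S k) :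
    l.prod ∈ wordBall S (k * l.length) := by
  induction l with
  | nil => exact one_mem_wordBall _ _
  | cons x l ih =>
    rw [List.prod_cons, List.length_cons, mul_add, mul_one, add_comm]
    exact mul_mem_wordBall (hl x (by simp)) (ih fun y hy => hl y (by simp [hy]))

theorem wordBall_subset_wordBall {T : Set G} {k : ℕ} (h : S ⊆ wordBall T k) (m : ℕ) :
    wordBall S m ⊆ wordBall T (k * m) := by
  rintro _ ⟨l, hl, hS, rfl⟩
  refine wordBall_mono (Nat.mul_le_mul_left k hl) (list_prod_mem_wordBall fun x hx => ?_)
  rcases hS x hx with hx | hx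
  · exact h hx
  · simpa using inv_mem_wordBall (h hx)

theorem exists_mem_wordBall (hS : Subgroup.closure S = ⊤) (x : G) : ∃ k, x ∈ wordBall S k := by
  obtain ⟨l, hl, rfl⟩ := Submonoid.exists_list_of_mem_closure (s := S ∪ S⁻¹) (x := x) (by
    simp [← Subgroup.closure_toSubmonoid, hS])
  exact ⟨l.length, l, le_rfl, hl, rfl⟩

theorem exists_subset_wordBall (hS : Subgroup.closure S = ⊤) {T : Set G} (hT : T.Finite) :
    ∃ k, T ⊆ wordBall S k := by
  induction T, hT using Set.Finite.induction_on with
  | empty => exact ⟨0, by simp⟩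
  | @insert a s _ _ ih =>
    obtain ⟨k, hk⟩ := ih
    obtain ⟨k', hk'⟩ := exists_mem_wordBall hS a
    refine ⟨max k k', Set.insert_subset (wordBall_mono (le_max_right _ _) hk') ?_⟩
    exact hk.trans (wordBall_mono (le_max_left _ _))

open scoped Pointwise in
theorem wordBall_add_subset (m m' : ℕ) : wordBall S (m + m') ⊆ wordBall S m * wordBall S m' := by
  rintro _ ⟨l, hl, hS, rfl⟩
  refine Set.mem_mul.2 ⟨(l.take m).prod, ⟨_, by simp, fun x hx => hS x (List.mem_of_mem_take hx),
    rfl⟩, (l.drop m).prod, ⟨_, by simp; omega, fun x hx => hS x (List.mem_of_mem_drop hx), rfl⟩, ?_⟩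
  exact List.prod_take_mul_prod_drop l m

open scoped Pointwise in
theorem finite_wordBall (hS : S.Finite) (m : ℕ) : (wordBall S m).Finite := by
  have h1 : (wordBall S 1).Finite := by
    refine ((hS.union hS.inv).insert 1).subset ?_
    rintro _ ⟨l, hl, hS, rfl⟩
    match l with
    | [] => simp
    | [x] => simpa using Or.inr (hS x (by simp))
    | x :: y :: l => simp at hl
  induction m with
  | zero => exact h1.subset (wordBall_mono (by simp))
  | succ m ih => exact (ih.mul h1).subset (wordBall_add_subset m 1)

open scoped Pointwise in
theorem Set.ncard_mul_le (A B : Set G) : (A * B).ncard ≤ A.ncard * B.ncard := by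
  simpa [Nat.card_coe_set_eq] using Set.natCard_mul_le (s := A) (t := B)

theorem ncard_wordBall_add_le (hS : S.Finite) (m m' : ℕ) :
    (wordBall S (m + m')).ncard ≤ (wordBall S m).ncard * (wordBall S m').ncard :=
  (Set.ncard_le_ncard (wordBall_add_subset m m')
    ((finite_wordBall hS m).mul (finite_wordBall hS m'))).trans (Set.ncard_mul_le _ _)

theorem ncard_wordBall_pos (hS : S.Finite) (m : ℕ) : 0 < (wordBall S m).ncard :=
  (Set.ncard_pos (finite_wordBall hS m)).2 ⟨1, one_mem_wordBall S m⟩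

end WordBall

namespace FreeGroup

variable {α : Type*} [DecidableEq α]

theorem finite_ncard_isPrefix_le (x : FreeGroup α) :
    {u | IsPrefix u x}.Finite ∧ {u | IsPrefix u x}.ncard ≤ x.norm + 1 := by
  have hinj : InjOn norm {u | IsPrefix u x} := fun u hu v hv h => IsPrefix.eq_of_norm_eq hu hv h
  have hmaps : MapsTo norm {u | IsPrefix u x} (Iic x.norm) := fun u hu => hu.norm_le
  refine ⟨Set.Finite.of_injOn hmaps hinj (Set.finite_Iic _), ?_⟩
  have hcard : (Iic x.norm).ncard = x.norm + 1 := by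
    rw [Set.ncard_eq_toFinset_card', Set.toFinset_Iic, Nat.card_Iic]
  exact hcard ▸ Set.ncard_le_ncard_of_injOn norm hmaps hinj (Set.finite_Iic _)

section Crossing

variable {G : Type*} [Group G] (S : Set G) (Φ : G →* FreeGroup α)

/-- The initial segments of the images of the letters. -/
def letterPrefixes : Set (FreeGroup α) := {d | d = 1 ∨ ∃ s, (s ∈ S ∨ s⁻¹ ∈ S) ∧ IsPrefix d (Φ s)}

/-- The initial segments of the images of the elements of the ball of radius `r`. -/
def ballPrefixes (r : ℕ) : Set (FreeGroup α) := {v | ∃ g ∈ wordBall S r, IsPrefix v (Φ g)}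

variable {S Φ}

theorem one_mem_ballPrefixes (r : ℕ) : 1 ∈ ballPrefixes S Φ r :=
  ⟨1, one_mem_wordBall S r, isPrefix_one _⟩

theorem exists_append_of_isPrefix {r : ℕ} {v : FreeGroup α} (hv : v ∉ ballPrefixes S Φ r)
    (l : List G) (hl : ∀ x ∈ l, x ∈ S ∨ x⁻¹ ∈ S) (h : IsPrefix v (Φ l.prod)) :
    ∃ l₁ l₂, l = l₁ ++ l₂ ∧ r ≤ l₁.length ∧ ∃ d ∈ letterPrefixes S Φ, v = Φ l₁.prod * d := by
  induction l using List.reverseRecOn with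
  | nil =>
    rw [List.prod_nil, MonoidHom.map_one] at h
    rw [isPrefix_one_right h] at hv
    exact absurd (one_mem_ballPrefixes r) hv
  | append_singleton l s ih =>
    have hlen : r ≤ l.length := by
      by_contra hlt
      exact hv ⟨(l ++ [s]).prod, ⟨_, by simp; omega, hl, rfl⟩, h⟩
    rw [List.prod_append, MonoidHom.map_mul] at h
    rcases h.isPrefix_or (p := Φ l.prod) with h | h
    · obtain ⟨l₁, l₂, rfl, h₁, hd⟩ := ih (fun x hx => hl x (by simp [hx])) h
      exact ⟨l₁, l₂ ++ [s], by simp, h₁, hd⟩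
    · refine ⟨l, [s], rfl, hlen, (Φ l.prod)⁻¹ * v, Or.inr ⟨s, hl s (by simp), ?_⟩, by simp⟩
      simpa using h

theorem exists_append_append_of_isPrefix {r : ℕ} {v v' : FreeGroup α}
    (hv : v ∉ ballPrefixes S Φ r) (hvv : IsPrefix v v')
    (l : List G) (hl : ∀ x ∈ l, x ∈ S ∨ x⁻¹ ∈ S) (h : IsPrefix v' (Φ l.prod)) :
    ∃ l₁ l₂ l₃, l = l₁ ++ l₂ ++ l₃ ∧ r ≤ l₁.length ∧ (∃ d ∈ letterPrefixes S Φ, v = Φ l₁.prod * d) ∧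
      ∃ d ∈ letterPrefixes S Φ, v' = Φ (l₁ ++ l₂).prod * d := by
  induction l using List.reverseRecOn with
  | nil =>
    obtain ⟨l₁, l₂, e, h₁, hd⟩ := exists_append_of_isPrefix hv [] (by simp) (hvv.trans h)
    obtain ⟨rfl, rfl⟩ := List.append_eq_nil_iff.1 e.symm
    refine ⟨[], [], [], rfl, h₁, hd, 1, Or.inl rfl, ?_⟩
    rw [List.prod_nil, MonoidHom.map_one] at h
    simp [isPrefix_one_right h]
  | append_singleton l s ih =>
    have hvl := hvv.trans h
    have hlen : r ≤ l.length := by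
      by_contra hlt
      exact hv ⟨(l ++ [s]).prod, ⟨_, by simp; omega, hl, rfl⟩, hvl⟩
    have hl' : ∀ x ∈ l, x ∈ S ∨ x⁻¹ ∈ S := fun x hx => hl x (by simp [hx])
    rw [List.prod_append, MonoidHom.map_mul] at h hvl
    have hd : ∀ u, IsPrefix ((Φ l.prod)⁻¹ * u) ((Φ l.prod)⁻¹ * (Φ l.prod * Φ [s].prod)) →
        ∃ d ∈ letterPrefixes S Φ, u = Φ l.prod * d := fun u hu =>
      ⟨(Φ l.prod)⁻¹ * u, Or.inr ⟨s, hl s (by simp), by simpa using hu⟩, by simp⟩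
    rcases h.isPrefix_or (p := Φ l.prod) with h | h
    · obtain ⟨l₁, l₂, l₃, rfl, h₁, hd⟩ := ih hl' h
      exact ⟨l₁, l₂, l₃ ++ [s], by simp, h₁, hd⟩
    · rcases hvl.isPrefix_or (p := Φ l.prod) with h' | h'
      · obtain ⟨l₁, l₂, rfl, h₁, hd'⟩ := exists_append_of_isPrefix hv l hl' h'
        exact ⟨l₁, l₂, [s], rfl, h₁, hd', hd _ h⟩
      · exact ⟨l, [], [s], by simp, hlen, hd _ h', by simpa using hd _ h⟩

open scoped Pointwise in
theorem ballPrefixes_subset (r : ℕ) :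
    ballPrefixes S Φ r ⊆ Φ '' wordBall S r * letterPrefixes S Φ := by
  rintro v ⟨_, ⟨l, hl, hS, rfl⟩, h⟩
  rw [Set.mem_mul]
  by_cases hv : v ∈ ballPrefixes S Φ 0
  · obtain ⟨_, ⟨l', hl', -, rfl⟩, h'⟩ := hv
    obtain rfl : l' = [] := by simpa using hl'
    rw [List.prod_nil, MonoidHom.map_one] at h'
    rw [isPrefix_one_right h']
    exact ⟨1, ⟨1, one_mem_wordBall S r, MonoidHom.map_one _⟩, 1, Or.inl rfl, one_mul 1⟩
  · obtain ⟨l₁, l₂, rfl, -, d, hd, rfl⟩ := exists_append_of_isPrefix hv l hS h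
    exact ⟨_, ⟨l₁.prod, ⟨l₁, by simp at hl; omega, fun x hx => hS x (by simp [hx]), rfl⟩, rfl⟩,
      d, hd, rfl⟩

theorem le_length_of_mul_eq {r : ℕ} {v d : FreeGroup α} (hv : v ∉ ballPrefixes S Φ r)
    (hd : d ∈ letterPrefixes S Φ) {l : List G} (hl : ∀ x ∈ l, x ∈ S ∨ x⁻¹ ∈ S)
    (h : Φ l.prod * v = d) : r ≤ l.length := by
  by_contra hlt
  have hmem : l.prod⁻¹ ∈ wordBall S l.length := inv_mem_wordBall ⟨l, le_rfl, hl, rfl⟩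
  have hv' : v = (Φ l.prod)⁻¹ * d := by rw [← h, inv_mul_cancel_left]
  rcases hd with rfl | ⟨s, hs, hd⟩
  · refine hv ⟨_, wordBall_mono (by omega) hmem, ?_⟩
    rw [hv', mul_one, MonoidHom.map_inv]
    exact isPrefix_refl _
  · have h2 : IsPrefix (((Φ l.prod)⁻¹)⁻¹ * v) (((Φ l.prod)⁻¹)⁻¹ * ((Φ l.prod)⁻¹ * Φ s)) := by
      simpa [h] using hd
    rcases isPrefix_or_isPrefix_of_isPrefix h2 with h3 | h3
    · exact hv ⟨_, wordBall_mono (by omega) hmem, by rwa [MonoidHom.map_inv]⟩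
    · exact hv ⟨l.prod⁻¹ * s, wordBall_mono (by omega)
        (mul_mem_wordBall (m' := 1) hmem ⟨[s], le_rfl, by simpa using hs, by simp⟩), by
        rwa [MonoidHom.map_mul, MonoidHom.map_inv]⟩

end Crossing

end FreeGroup

namespace FreeGroup

variable {α : Type*} [DecidableEq α] {T : Set (FreeGroup α)}

/-- `y` if the sign is positive, and its inverse otherwise. -/
def signed (y : FreeGroup α) (b : Bool) : FreeGroup α := cond b y y⁻¹

omit [DecidableEq α] in
theorem signed_not (y : FreeGroup α) (b : Bool) : signed y (!b) = (signed y b)⁻¹ := by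
  cases b <;> simp [signed]

/-- `q` is the shortest prefix of `y` outside `T`. -/
def IsExitPrefix (T : Set (FreeGroup α)) (y q : FreeGroup α) : Prop :=
  IsPrefix q y ∧ q ∉ T ∧ ∀ u, IsPrefix u y → u.norm < q.norm → u ∈ T

theorem exists_isExitPrefix {y v : FreeGroup α} (hv : v ∉ T) (hvy : IsPrefix v y) :
    ∃ q, IsExitPrefix T y q := by
  classical
  have hex : ∃ k, ∃ q, IsPrefix q y ∧ q ∉ T ∧ q.norm = k := ⟨_, v, hvy, hv, rfl⟩
  obtain ⟨q, hq, hqT, hqn⟩ := Nat.find_spec hex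
  refine ⟨q, hq, hqT, fun u hu hlt => ?_⟩
  by_contra huT
  exact Nat.find_min hex (hqn ▸ hlt) ⟨u, hu, huT, rfl⟩

theorem IsExitPrefix.isPrefix_mul {y q q' z : FreeGroup α} (h1 : 1 ∈ T)
    (hy : ∀ t₁ ∈ T, ∀ t₂ ∈ T, y ≠ t₁ * t₂⁻¹) (hq : IsExitPrefix T y q)
    (hq' : IsExitPrefix T y⁻¹ q') (hz : ¬ IsPrefix q' z) : IsPrefix q (y * z) := by
  obtain ⟨hqy, hqT, hqmin⟩ := hq
  obtain ⟨hqy', hqT', hqmin'⟩ := hq'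
  have hpos : 0 < q.norm := by
    rw [Nat.pos_iff_ne_zero, Ne, norm_eq_zero]
    rintro rfl
    exact hqT h1
  have hle := hqy.norm_le
  have hsum : q.norm + q'.norm ≤ y.norm + 1 := by
    obtain ⟨t, ht, htn⟩ := exists_isPrefix y (t := q.norm - 1) (by omega)
    have hn : t.norm + (y⁻¹ * t).norm = y.norm := by
      rw [← norm_inv_eq (x := y⁻¹ * t), mul_inv_rev, inv_inv]
      exact ht
    have hpre : IsPrefix (y⁻¹ * t) y⁻¹ := by
      unfold IsPrefix
      rw [mul_inv_rev, inv_inv, mul_inv_cancel_right, norm_inv_eq, norm_inv_eq]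
      omega
    by_contra hlt
    refine hy t (hqmin t ht (by omega)) _ (hqmin' _ hpre (by omega)) ?_
    group
  have h1 := norm_inv_mul y (y * z)
  have h2 := norm_mul y z
  rw [inv_mul_cancel_left] at h1
  rw [isPrefix_iff] at *
  have h3 := min_commonPrefix_le q' y⁻¹ z
  have h4 := commonPrefix_le_left q' z
  have h5 := min_commonPrefix_le q y (y * z)
  have h6 := commonPrefix_le_left q (y * z)
  omega

/-- A ping-pong criterion: the `yᵢ` generate a free group as soon as the `yᵢ` and their inverses
leave the prefix-closed set `T` along pairwise diverging rays. -/
theorem injective_lift_of_diverging {β : Type} [DecidableEq β] {T : Set (FreeGroup β)} {n : ℕ}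
    (h1 : 1 ∈ T) (y : Fin n → FreeGroup β)
    (hmul : ∀ i, ∀ t₁ ∈ T, ∀ t₂ ∈ T, y i ≠ t₁ * t₂⁻¹)
    (hinv : ∀ i v, IsPrefix v (y i) → IsPrefix v (y i)⁻¹ → v ∈ T)
    (hne : ∀ i j, i ≠ j → ∀ b c v, IsPrefix v (signed (y i) b) → IsPrefix v (signed (y j) c) →
      v ∈ T) :
    Function.Injective (lift y) := by
  have hyT : ∀ i b, signed (y i) b ∉ T := by
    intro i b hb
    cases b
    · exact hmul i 1 h1 _ hb (by simp [signed])
    · exact hmul i _ hb 1 h1 (by simp [signed])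
  have hmul' : ∀ i b, ∀ t₁ ∈ T, ∀ t₂ ∈ T, signed (y i) b ≠ t₁ * t₂⁻¹ := by
    intro i b t₁ ht₁ t₂ ht₂ h
    cases b
    · refine hmul i t₂ ht₂ t₁ ht₁ ?_
      rw [← inv_inj, mul_inv_rev, inv_inv]
      exact h
    · exact hmul i t₁ ht₁ t₂ ht₂ h
  choose q hq using fun (p : Fin n × Bool) =>
    exists_isExitPrefix (hyT p.1 p.2) (isPrefix_refl _)
  have hdiv : ∀ p p' : Fin n × Bool, p ≠ p' → ∀ v, IsPrefix v (signed (y p.1) p.2) →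
      IsPrefix v (signed (y p'.1) p'.2) → v ∈ T := by
    rintro ⟨i, b⟩ ⟨j, c⟩ hp v hv hv'
    by_cases hij : i = j
    · subst hij
      cases b <;> cases c
      · exact absurd rfl hp
      · exact hinv i v hv' hv
      · exact hinv i v hv hv'
      · exact absurd rfl hp
    · exact hne i j hij b c v hv hv'
  have hdisj : ∀ p p' : Fin n × Bool, p ≠ p' → Disjoint {z | IsPrefix (q p) z}
      {z | IsPrefix (q p') z} := by
    intro p p' hp
    rw [Set.disjoint_left]
    intro z (hz : IsPrefix _ z) (hz' : IsPrefix _ z)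
    rcases le_total (q p).norm (q p').norm with hle | hle
    · exact (hq p).2.1 (hdiv p p' hp _ (hq p).1 ((hz.of_norm_le hz' hle).trans (hq p').1))
    · exact (hq p').2.1 (hdiv p p' hp _ ((hz'.of_norm_le hz hle).trans (hq p).1) (hq p').1)
  have hpp : ∀ i b z, ¬ IsPrefix (q (i, !b)) z → IsPrefix (q (i, b)) (signed (y i) b * z) :=
    fun i b z hz => (hq (i, b)).isPrefix_mul h1 (hmul' i b)
      (by have := hq (i, !b); rwa [signed_not] at this) hz
  rcases le_or_gt n 1 with hn | hn
  · have : Subsingleton (Fin n) := Fin.subsingleton_iff_le_one.2 hn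
    rw [injective_iff_map_eq_one]
    intro x hx
    rcases isEmpty_or_nonempty (Fin n) with he | ⟨⟨i⟩⟩
    · exact Subsingleton.elim _ _
    have hxz : x ∈ Subgroup.zpowers (of i) := by
      have hr : range (of : Fin n → FreeGroup (Fin n)) = {of i} := by
        ext w
        refine ⟨?_, fun hw => ⟨i, hw.symm⟩⟩
        rintro ⟨j, rfl⟩
        rw [Subsingleton.elim j i]
        rfl
      rw [Subgroup.zpowers_eq_closure, ← hr, closure_range_of]
      trivial
    obtain ⟨k, rfl⟩ := Subgroup.mem_zpowers_iff.1 hxz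
    have hy : y i ≠ 1 := fun h => hyT i true (by simpa [signed, h] using h1)
    rw [MonoidHom.map_zpow, lift_apply_of, IsMulTorsionFree.zpow_eq_one_iff_right hy] at hx
    rw [hx, zpow_zero]
  · have : Nontrivial (Fin n) := Fin.nontrivial_iff_two_le.2 hn
    refine injective_lift_of_ping_pong y (fun i => {z | IsPrefix (q (i, true)) z})
      (fun i => {z | IsPrefix (q (i, false)) z}) (fun i => ⟨_, isPrefix_refl _⟩)
      (fun i j hij => hdisj _ _ (by simpa using hij))
      (fun i j hij => hdisj _ _ (by simpa using hij))
      (fun i j => hdisj _ _ (by simp)) ?_ ?_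
    · rintro i _ ⟨z, hz, rfl⟩
      exact hpp i true z hz
    · rintro i _ ⟨z, hz, rfl⟩
      exact hpp i false z hz

omit [DecidableEq α] in
theorem isFreeBasisTuple_of_map {G : Type*} [Group G] (Φ : G →* FreeGroup α) {n : ℕ}
    {x : Fin n → G} (h : Function.Injective (lift fun i => Φ (x i))) : IsFreeBasisTuple x := by
  have e : lift (fun i => Φ (x i)) = Φ.comp (lift x) := by ext; simp
  rw [e] at h
  exact Function.Injective.of_comp h

end FreeGroup

namespace FreeGroup

theorem finite_setOf_norm_le (α : Type*) [DecidableEq α] [Finite α] (m : ℕ) :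
    {x : FreeGroup α | x.norm ≤ m}.Finite :=
  (finite_wordBall (Set.finite_range of) m).subset fun _ hx =>
    mem_wordBall_of_norm_le (MonoidHom.id _) (fun i => Or.inl (Set.mem_range_self i)) hx

variable {α : Type*} [DecidableEq α]

theorem IsPrefix.isPrefix_mul_self {v y : FreeGroup α} (hy : y ≠ 1) (hv : IsPrefix v y)
    (hv' : IsPrefix v y⁻¹) : IsPrefix v (y * v) := by
  have hlen : v.norm + (y * v).norm = y.norm := by
    unfold IsPrefix at hv'
    rwa [← mul_inv_rev, norm_inv_eq, norm_inv_eq] at hv'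
  have hw : IsPrefix (y * v) y := by
    unfold IsPrefix
    rw [mul_inv_rev, inv_mul_cancel_right, norm_inv_eq]
    omega
  rcases le_total v.norm (y * v).norm with hle | hle
  · exact hv.of_norm_le hw hle
  set w := y * v with hwdef
  have hwv : IsPrefix w v := hw.of_norm_le hv hle
  set u := w⁻¹ * v with hu
  have hun : w.norm + u.norm = v.norm := hwv
  have hyw : (w * u⁻¹)⁻¹ * y = w⁻¹ := by rw [hu, hwdef]; group
  have h1 := norm_mul_le w u⁻¹
  have h2 := norm_mul_le (w * u⁻¹) ((w * u⁻¹)⁻¹ * y)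
  rw [mul_inv_cancel_left, hyw, norm_inv_eq] at h2
  rw [norm_inv_eq] at h1
  have hpre : IsPrefix (w * u⁻¹) y := by
    unfold IsPrefix
    rw [hyw, norm_inv_eq]
    omega
  have heq : w * u⁻¹ = v := hpre.eq_of_norm_eq hv (by omega)
  have hu1 : u⁻¹ = u := eq_inv_mul_of_mul_eq heq
  rw [inv_eq_self] at hu1
  rw [hu1, inv_one, mul_one] at heq
  exact absurd (by simpa [hwdef] using heq) hy

section Counting

variable {G : Type*} [Group G] {S : Set G} {Φ : G →* FreeGroup α}

theorem finite_ncard_letterPrefixes_le (hS : S.Finite) {L : ℕ} (hL : ∀ s ∈ S, (Φ s).norm ≤ L) :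
    (letterPrefixes S Φ).Finite ∧
      (letterPrefixes S Φ).ncard ≤ 1 + (S.ncard + S.ncard) * (L + 1) := by
  classical
  have hS' := hS.union hS.inv
  have hsub : letterPrefixes S Φ ⊆
      ↑(insert 1 (hS'.toFinset.biUnion fun s => (finite_ncard_isPrefix_le (Φ s)).1.toFinset)) := by
    rintro d (rfl | ⟨s, hs, hd⟩)
    · simp
    · simp only [Finset.coe_insert, Set.mem_insert_iff, Finset.mem_coe, Finset.mem_biUnion]
      exact Or.inr ⟨s, by simpa using hs, by simpa using hd⟩
  refine ⟨(Finset.finite_toSet _).subset hsub, ?_⟩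
  refine (Set.ncard_le_ncard hsub (Finset.finite_toSet _)).trans ?_
  rw [Set.ncard_coe_finset, add_comm]
  refine (Finset.card_insert_le _ _).trans (Nat.add_le_add_right ?_ 1)
  refine (Finset.card_biUnion_le_card_mul _ _ (L + 1) fun s hs => ?_).trans ?_
  · rw [← Set.ncard_eq_toFinset_card _ (finite_ncard_isPrefix_le (Φ s)).1]
    refine (finite_ncard_isPrefix_le (Φ s)).2.trans (Nat.add_le_add_right ?_ 1)
    rcases (Set.mem_union _ _ _).1 (hS'.mem_toFinset.1 hs) with hs | hs
    · exact hL s hs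
    · simpa using hL _ hs
  · refine Nat.mul_le_mul_right _ ?_
    rw [← Set.ncard_eq_toFinset_card _ hS']
    refine (Set.ncard_union_le _ _).trans (Nat.add_le_add_left ?_ _)
    rw [Set.ncard_inv]

theorem finite_ncard_ballPrefixes_le (hS : S.Finite) (hD : (letterPrefixes S Φ).Finite) (r : ℕ) :
    (ballPrefixes S Φ r).Finite ∧
      (ballPrefixes S Φ r).ncard ≤ (wordBall S r).ncard * (letterPrefixes S Φ).ncard := by
  have hB := (finite_wordBall hS r).image Φ
  refine ⟨(hB.mul hD).subset (ballPrefixes_subset r), ?_⟩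
  refine (Set.ncard_le_ncard (ballPrefixes_subset r) (hB.mul hD)).trans ?_
  exact (Set.ncard_mul_le _ _).trans
    (Nat.mul_le_mul_right _ (Set.ncard_image_le (finite_wordBall hS r)))

variable (S Φ) in
/-- The elements of the ball of radius `m` whose image is a quotient of two elements of the
set of prefixes of the ball of radius `r`. -/
def shortElements (m r : ℕ) : Set G :=
  {x ∈ wordBall S m | ∃ t₁ ∈ ballPrefixes S Φ r, ∃ t₂ ∈ ballPrefixes S Φ r, Φ x = t₁ * t₂⁻¹}

variable (S Φ) in
/-- The elements of the ball of radius `m` whose image shares with its inverse a prefix outside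
the set of prefixes of the ball of radius `r`. -/
def conjugateElements (m r : ℕ) : Set G :=
  {x ∈ wordBall S m | ∃ v ∉ ballPrefixes S Φ r, IsPrefix v (Φ x) ∧ IsPrefix v (Φ x)⁻¹}

variable (S Φ) in
/-- The elements of the ball of radius `m` whose image, up to inversion, shares with that of `h`
a prefix outside the set of prefixes of the ball of radius `r`. -/
def fellowElements (m r : ℕ) (h : G) : Set G :=
  {x ∈ wordBall S m | ∃ b c, ∃ v ∉ ballPrefixes S Φ r,
    IsPrefix v (signed (Φ x) b) ∧ IsPrefix v (signed (Φ h) c)}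

theorem ncard_shortElements_le (hS : S.Finite) (hD : (letterPrefixes S Φ).Finite) {m r : ℕ}
    (hinj : InjOn Φ (wordBall S m)) : (shortElements S Φ m r).ncard ≤
      ((wordBall S r).ncard * (letterPrefixes S Φ).ncard) ^ 2 := by
  obtain ⟨hT, hTn⟩ := finite_ncard_ballPrefixes_le hS hD r
  have h1 : (shortElements S Φ m r).ncard ≤
      ((fun p : FreeGroup α × FreeGroup α => p.1 * p.2⁻¹) ''
        (ballPrefixes S Φ r ×ˢ ballPrefixes S Φ r)).ncard := by
    refine Set.ncard_le_ncard_of_injOn Φ ?_ (hinj.mono fun x hx => hx.1) ((hT.prod hT).image _)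
    rintro x ⟨-, t₁, ht₁, t₂, ht₂, h⟩
    exact ⟨(t₁, t₂), ⟨ht₁, ht₂⟩, h.symm⟩
  refine (h1.trans (Set.ncard_image_le (hT.prod hT))).trans ?_
  rw [Set.ncard_prod, ← sq]
  exact Nat.pow_le_pow_left hTn 2

theorem ncard_conjugateElements_le [Finite α] (hS : S.Finite) (hD : (letterPrefixes S Φ).Finite)
    {m r : ℕ} (hinj : InjOn Φ (wordBall S m)) : (conjugateElements S Φ m r).ncard ≤
      (wordBall S r).ncard * (letterPrefixes S Φ).ncard * {c : FreeGroup α | c.norm ≤ 1}.ncard *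
        ((letterPrefixes S Φ).ncard * (wordBall S (m - (r + r))).ncard *
          (letterPrefixes S Φ).ncard) := by
  obtain ⟨hT, hTn⟩ := finite_ncard_ballPrefixes_le hS hD r
  have hC := finite_setOf_norm_le α 1
  have hB := finite_wordBall hS (m - (r + r))
  have hfin := (hT.prod hC).prod ((hD.prod hB).prod hD)
  have h1 : (conjugateElements S Φ m r).ncard ≤
      ((fun p : (FreeGroup α × FreeGroup α) × ((FreeGroup α × G) × FreeGroup α) =>
        (p.1.1 * p.1.2) * (p.2.1.1⁻¹ * Φ p.2.1.2 * p.2.2) * (p.1.1 * p.1.2)⁻¹) ''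
        ((ballPrefixes S Φ r ×ˢ {c | c.norm ≤ 1}) ×ˢ
          ((letterPrefixes S Φ ×ˢ wordBall S (m - (r + r))) ×ˢ letterPrefixes S Φ))).ncard := by
    refine Set.ncard_le_ncard_of_injOn Φ ?_ (hinj.mono fun x hx => hx.1) (hfin.image _)
    rintro _ ⟨⟨l, hl, hlS, rfl⟩, v, hv, hvx, hvx'⟩
    obtain ⟨q, hq, hqT, hqmin⟩ := exists_isExitPrefix hv hvx
    have hq' : IsPrefix q (Φ l.prod)⁻¹ := by
      refine (hq.of_norm_le hvx ?_).trans hvx'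
      by_contra hlt
      exact hv (hqmin v hvx (by omega))
    have hq1 : q ≠ 1 := by
      rintro rfl
      exact hqT (one_mem_ballPrefixes r)
    have hpos : 0 < q.norm := by rwa [Nat.pos_iff_ne_zero, Ne, norm_eq_zero]
    have hx1 : Φ l.prod ≠ 1 := by
      intro h
      rw [h] at hq
      exact hq1 (isPrefix_one_right hq)
    obtain ⟨t, ht, htn⟩ := exists_isPrefix q (t := q.norm - 1) (by omega)
    have hpre : IsPrefix (Φ l.prod * q) (Φ l.prod) := by
      unfold IsPrefix at hq' ⊢
      rw [← mul_inv_rev, norm_inv_eq, norm_inv_eq] at hq'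
      rw [mul_inv_rev, inv_mul_cancel_right, norm_inv_eq]
      omega
    obtain ⟨l₁, l₂, l₃, rfl, h₁, ⟨d, hd, hdv⟩, d', hd', hdv'⟩ :=
      exists_append_append_of_isPrefix hqT (hq.isPrefix_mul_self hx1 hq') l hlS hpre
    have h₃ : r ≤ l₃.length := by
      refine le_length_of_mul_eq hqT hd' (fun x hx => hlS x (by simp [hx])) ?_
      rw [List.prod_append, MonoidHom.map_mul, mul_assoc] at hdv'
      exact mul_left_cancel hdv'
    refine ⟨((t, t⁻¹ * q), ((d, l₂.prod), d')), ⟨⟨hqmin t (ht.trans hq) (by omega), ?_⟩,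
      ⟨hd, l₂, ?_, fun x hx => hlS x (by simp [hx]), rfl⟩, hd'⟩, ?_⟩
    · unfold IsPrefix at ht
      simp only [Set.mem_ofPred_eq]
      omega
    · simp only [List.length_append] at hl
      omega
    · have e : q * d⁻¹ = Φ l₁.prod := by rw [hdv]; group
      rw [List.prod_append (l₁ := l₁), MonoidHom.map_mul, ← e] at hdv'
      simp only [mul_inv_cancel_left]
      rw [eq_mul_inv_of_mul_eq hdv']
      group
  refine (h1.trans (Set.ncard_image_le hfin)).trans ?_
  simp only [Set.ncard_prod]
  gcongr

theorem ncard_fellowElements_le (hS : S.Finite) (hD : (letterPrefixes S Φ).Finite)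
    {m r : ℕ} (hinj : InjOn Φ (wordBall S m)) (h : G) : (fellowElements S Φ m r h).ncard ≤
      2 * ((Φ h).norm + 1 + ((Φ h).norm + 1)) *
        ((letterPrefixes S Φ).ncard * (wordBall S (m - r)).ncard) := by
  have hB := finite_wordBall hS (m - r)
  have hP := fun c => finite_ncard_isPrefix_le (signed (Φ h) c)
  have hP' := (hP true).1.union (hP false).1
  have hfin := ((Set.finite_univ (α := Bool)).prod hP').prod (hD.prod hB)
  have h1 : (fellowElements S Φ m r h).ncard ≤
      ((fun p : (Bool × FreeGroup α) × (FreeGroup α × G) =>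
        signed (p.1.2 * p.2.1⁻¹ * Φ p.2.2) p.1.1) ''
        ((univ ×ˢ ({u | IsPrefix u (signed (Φ h) true)} ∪ {u | IsPrefix u (signed (Φ h) false)})) ×ˢ
          (letterPrefixes S Φ ×ˢ wordBall S (m - r)))).ncard := by
    refine Set.ncard_le_ncard_of_injOn Φ ?_ (hinj.mono fun x hx => hx.1) (hfin.image _)
    rintro x ⟨hx, b, c, v, hv, hvx, hvh⟩
    obtain ⟨l, hl, hlS, hlx⟩ : ∃ l : List G, l.length ≤ m ∧ (∀ x ∈ l, x ∈ S ∨ x⁻¹ ∈ S) ∧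
        Φ l.prod = signed (Φ x) b := by
      cases b
      · obtain ⟨l, hl, hlS, hlx⟩ := inv_mem_wordBall hx
        exact ⟨l, hl, hlS, by rw [hlx, MonoidHom.map_inv]; rfl⟩
      · obtain ⟨l, hl, hlS, hlx⟩ := hx
        exact ⟨l, hl, hlS, by rw [hlx]; rfl⟩
    rw [← hlx] at hvx
    obtain ⟨l₁, l₂, rfl, h₁, d, hd, hdv⟩ := exists_append_of_isPrefix hv l hlS hvx
    refine ⟨((b, v), (d, l₂.prod)), ⟨⟨trivial, ?_⟩,
      hd, l₂, ?_, fun x hx => hlS x (by simp [hx]), rfl⟩, ?_⟩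
    · cases c
      · exact Or.inr hvh
      · exact Or.inl hvh
    · simp only [List.length_append] at hl
      omega
    · simp only [hdv, mul_inv_cancel_right]
      rw [← MonoidHom.map_mul, ← List.prod_append, hlx]
      cases b <;> simp [signed]
  refine (h1.trans (Set.ncard_image_le hfin)).trans ?_
  simp only [Set.ncard_prod]
  gcongr
  · simp
  · refine (Set.ncard_union_le _ _).trans (Nat.add_le_add ((hP true).2) ?_)
    simpa [signed] using (hP false).2

end Counting

end FreeGroup

theorem Finset.card_pow_succ_le_add {G : Type*} {k : ℕ} (B A : Finset G) (C : G → Finset G)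
    {a c : ℕ} (hA : A.card ≤ a) (hC : ∀ h ∈ B, (C h).card ≤ c) (P : (Fin (k + 1) → G) → Prop)
    (hP : ∀ x, (∀ i, x i ∈ B) → (∀ i, x i ∉ A) → (∀ i j, i ≠ j → x i ∉ C (x j)) → P x) :
    B.card ^ (k + 1) ≤ {x | (∀ i, x i ∈ B) ∧ P x}.ncard + (k + 1) * (B.card ^ k * (a + k * c)) := by
  classical
  set Q := Fintype.piFinset fun _ : Fin (k + 1) => B with hQ
  have hgood : {x | (∀ i, x i ∈ B) ∧ P x} = ↑(Q.filter P) := by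
    ext x
    simp [hQ]
  let E : (Fin k → G) → Finset G := fun y => A ∪ Finset.univ.biUnion fun j => C (y j)
  let R : Fin (k + 1) → Finset (Fin (k + 1) → G) := fun i =>
    (Fintype.piFinset fun _ : Fin k => B).biUnion fun y => (E y).image fun z => i.insertNth z y
  have hR : ∀ i, (R i).card ≤ B.card ^ k * (a + k * c) := by
    intro i
    refine (Finset.card_biUnion_le_card_mul _ _ (a + k * c) fun y hy => ?_).trans ?_
    · refine Finset.card_image_le.trans ((Finset.card_union_le _ _).trans (Nat.add_le_add hA ?_))
      refine (Finset.card_biUnion_le_card_mul _ _ c fun j _ => ?_).trans (by simp)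
      exact hC _ (Fintype.mem_piFinset.1 hy j)
    · rw [Fintype.card_piFinset_const]
  have hsub : Q ⊆ Q.filter P ∪ Finset.univ.biUnion R := by
    intro x hx
    rw [hQ, Fintype.mem_piFinset] at hx
    by_cases h : ∃ i, x i ∈ E (i.removeNth x)
    · obtain ⟨i, hi⟩ := h
      refine Finset.mem_union_right _ (Finset.mem_biUnion.2 ⟨i, Finset.mem_univ i, ?_⟩)
      refine Finset.mem_biUnion.2 ⟨i.removeNth x, Fintype.mem_piFinset.2 fun j => hx _, ?_⟩
      exact Finset.mem_image.2 ⟨x i, hi, Fin.insertNth_self_removeNth i x⟩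
    · push Not at h
      refine Finset.mem_union_left _ (Finset.mem_filter.2 ⟨Fintype.mem_piFinset.2 hx, hP x hx
        (fun i hi => h i (Finset.mem_union_left _ hi)) fun i j hij hi => h i ?_⟩)
      obtain ⟨j, rfl⟩ := Fin.exists_succAbove_eq hij.symm
      exact Finset.mem_union_right _ (Finset.mem_biUnion.2 ⟨j, Finset.mem_univ j, hi⟩)
  rw [hgood, Set.ncard_coe_finset]
  calc B.card ^ (k + 1) = Q.card := by rw [hQ, Fintype.card_piFinset_const]
    _ ≤ (Q.filter P).card + (Finset.univ.biUnion R).card :=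
      (Finset.card_le_card hsub).trans (Finset.card_union_le _ _)
    _ ≤ _ := Nat.add_le_add_left ((Finset.card_biUnion_le_card_mul _ _ _ fun i _ => hR i).trans
      (by simp)) _

/-- The tuples of a ball that fail to be free basis tuples, counted by means of a homomorphism
to a free group that is injective on the ball. -/
theorem ncard_wordBall_pow_le {G : Type*} [Group G] {S : Set G} (hS : S.Finite) {α : Type}
    [DecidableEq α] [Finite α] {Φ : G →* FreeGroup α} {m r L d : ℕ} (k : ℕ)
    (hinj : InjOn Φ (wordBall S m)) (hL : ∀ x ∈ wordBall S m, (Φ x).norm ≤ L)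
    (hD : (FreeGroup.letterPrefixes S Φ).Finite)
    (hd : (FreeGroup.letterPrefixes S Φ).ncard ≤ d) :
    (wordBall S m).ncard ^ (k + 1) ≤
      {x : Fin (k + 1) → G | (∀ i, x i ∈ wordBall S m) ∧ IsFreeBasisTuple x}.ncard +
      (k + 1) * ((wordBall S m).ncard ^ k *
        (((wordBall S r).ncard * d) ^ 2 +
          (wordBall S r).ncard * d * {c : FreeGroup α | c.norm ≤ 1}.ncard *
            (d * (wordBall S (m - (r + r))).ncard * d) +
          k * (2 * (L + 1 + (L + 1)) * (d * (wordBall S (m - r)).ncard)))) := by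
  classical
  have hB := finite_wordBall hS m
  have hfin : ∀ T ⊆ wordBall S m, T.Finite := fun T hT => hB.subset hT
  have h1 := hfin (FreeGroup.shortElements S Φ m r) fun x hx => hx.1
  have h2 := hfin (FreeGroup.conjugateElements S Φ m r) fun x hx => hx.1
  have h3 := fun h => hfin (FreeGroup.fellowElements S Φ m r h) fun x hx => hx.1
  have key := Finset.card_pow_succ_le_add (k := k) hB.toFinset (h1.toFinset ∪ h2.toFinset)
    (fun h => (h3 h).toFinset)
    (a := ((wordBall S r).ncard * d) ^ 2 +
      (wordBall S r).ncard * d * {c : FreeGroup α | c.norm ≤ 1}.ncard *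
        (d * (wordBall S (m - (r + r))).ncard * d))
    (c := 2 * (L + 1 + (L + 1)) * (d * (wordBall S (m - r)).ncard)) ?_ ?_ IsFreeBasisTuple ?_
  · simpa only [← Set.ncard_eq_toFinset_card _ hB, Set.Finite.mem_toFinset] using key
  · refine (Finset.card_union_le _ _).trans (Nat.add_le_add ?_ ?_)
    · rw [← Set.ncard_eq_toFinset_card _ h1]
      refine (FreeGroup.ncard_shortElements_le hS hD hinj).trans ?_
      gcongr
    · rw [← Set.ncard_eq_toFinset_card _ h2]
      refine (FreeGroup.ncard_conjugateElements_le hS hD hinj).trans ?_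
      gcongr
  · intro h hh
    rw [← Set.ncard_eq_toFinset_card _ (h3 h)]
    have := hL h (hB.mem_toFinset.1 hh)
    refine (FreeGroup.ncard_fellowElements_le hS hD hinj h).trans ?_
    gcongr
  · intro x hxB hxA hxC
    simp only [Set.Finite.mem_toFinset, Finset.mem_union, not_or] at hxB hxA hxC
    refine FreeGroup.isFreeBasisTuple_of_map Φ (FreeGroup.injective_lift_of_diverging
      (T := FreeGroup.ballPrefixes S Φ r) (FreeGroup.one_mem_ballPrefixes r) _ ?_ ?_ ?_)
    · exact fun i t₁ ht₁ t₂ ht₂ h => (hxA i).1 ⟨hxB i, t₁, ht₁, t₂, ht₂, h⟩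
    · intro i v hv hv'
      by_contra hvT
      exact (hxA i).2 ⟨hxB i, v, hvT, hv, hv'⟩
    · intro i j hij b c v hv hv'
      by_contra hvT
      exact hxC i j hij ⟨hxB i, b, c, v, hvT, hv, hv'⟩

/-- A submultiplicative sequence of exponential growth is squeezed between exponentials whose
rates are as close as desired. -/
theorem exists_exp_bounds {b : ℕ → ℕ} (hpos : ∀ m, 0 < b m) (hmono : Monotone b)
    (hmul : ∀ m m', b (m + m') ≤ b m * b m') {K : ℕ} (hK : 0 < K) (hgrow : ∀ m, 2 ^ m ≤ b (K * m)) :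
    ∃ h > 0, ∃ C ≥ (1 : ℝ), (∀ m : ℕ, Real.exp (h * m) ≤ b m) ∧
      ∀ m : ℕ, (b m : ℝ) ≤ C * Real.exp (9 / 8 * h * m) := by
  have hpos' : ∀ m, (0 : ℝ) < b m := fun m => Nat.cast_pos.2 (hpos m)
  have hone : ∀ m, (1 : ℝ) ≤ b m := fun m => Nat.one_le_cast.2 (hpos m)
  have hsub : Subadditive fun m => Real.log (b m) := by
    intro m m'
    rw [← Real.log_mul (hpos' m).ne' (hpos' m').ne']
    exact Real.log_le_log (hpos' _) (by exact_mod_cast hmul m m')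
  have hbdd : BddBelow (range fun m : ℕ => Real.log (b m) / m) := by
    refine ⟨0, ?_⟩
    rintro _ ⟨m, rfl⟩
    exact div_nonneg (Real.log_nonneg (hone m)) (Nat.cast_nonneg m)
  have hlim := hsub.tendsto_lim hbdd
  set h := hsub.lim
  have hh : 0 < h := by
    have hK' : (0 : ℝ) < K := Nat.cast_pos.2 hK
    refine lt_of_lt_of_le (div_pos (Real.log_pos one_lt_two) hK') ?_
    have hsubseq : Tendsto (fun m : ℕ => K * m) atTop atTop :=
      tendsto_id.const_mul_atTop' hK
    refine ge_of_tendsto (hlim.comp hsubseq) ((eventually_gt_atTop 0).mono fun m hm => ?_)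
    have hm' : (0 : ℝ) < m := Nat.cast_pos.2 hm
    have h2 : (m : ℝ) * Real.log 2 ≤ Real.log (b (K * m)) := by
      rw [← Real.log_pow]
      exact Real.log_le_log (by positivity) (by exact_mod_cast hgrow m)
    simp only [Function.comp_apply, Nat.cast_mul]
    rw [div_le_div_iff₀ hK' (by positivity)]
    nlinarith
  obtain ⟨N, hN⟩ := eventually_atTop.1
    ((hlim.eventually (gt_mem_nhds (show h < 9 / 8 * h by linarith))).and (eventually_gt_atTop 0))
  refine ⟨h, hh, b N, hone N, fun m => ?_, fun m => ?_⟩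
  · rw [← Real.le_log_iff_exp_le (hpos' m)]
    rcases Nat.eq_zero_or_pos m with rfl | hm
    · simpa using Real.log_nonneg (hone 0)
    · exact (le_div_iff₀ (Nat.cast_pos.2 hm)).1 (hsub.lim_le_div hbdd hm.ne')
  · rcases le_total m N with hm | hm
    · have h1 : (1 : ℝ) ≤ Real.exp (9 / 8 * h * m) := Real.one_le_exp (by positivity)
      have h2 : (b m : ℝ) ≤ b N := Nat.cast_le.2 (hmono hm)
      nlinarith [hpos' N]
    · have h1 : Real.log (b m) ≤ 9 / 8 * h * m :=
        ((div_lt_iff₀ (Nat.cast_pos.2 (hN m hm).2)).1 (hN m hm).1).le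
      rw [Real.log_le_iff_le_exp (hpos' m)] at h1
      nlinarith [hone N, Real.exp_pos (9 / 8 * h * m)]

theorem tendsto_eval_mul_exp_neg (Q : Polynomial ℝ) {c : ℝ} (hc : 0 < c) :
    Tendsto (fun m : ℕ => Q.eval (m : ℝ) * Real.exp (-(c * m))) atTop (nhds 0) := by
  have h1 := Q.comp (Polynomial.C c⁻¹ * Polynomial.X) |>.tendsto_div_exp_atTop
  have h2 : Tendsto (fun m : ℕ => c * (m : ℝ)) atTop atTop :=
    tendsto_natCast_atTop_atTop.const_mul_atTop hc
  refine (h1.comp h2).congr fun m => ?_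
  simp [Real.exp_neg, div_eq_mul_inv, hc.ne']

theorem FreeGroup.norm_map_le_of_mem_wordBall {G α : Type*} [Group G] [DecidableEq α] {S : Set G}
    {Φ : G →* FreeGroup α} {L m : ℕ} (hL : ∀ s ∈ S, (Φ s).norm ≤ L) {x : G}
    (hx : x ∈ wordBall S m) : (Φ x).norm ≤ m * L := by
  obtain ⟨l, hl, hS, rfl⟩ := hx
  refine le_trans ?_ (Nat.mul_le_mul_right L hl)
  clear hl
  induction l with
  | nil => simp
  | cons s l ih =>
    rw [List.prod_cons, MonoidHom.map_mul, List.length_cons, Nat.succ_mul, add_comm]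
    refine (FreeGroup.norm_mul_le _ _).trans
      (Nat.add_le_add ?_ (ih fun x hx => hS x (List.mem_cons_of_mem _ hx)))
    rcases hS s (by simp) with hs | hs
    · exact hL s hs
    · simpa using hL _ hs

theorem bad_count_le {b : ℕ → ℕ} {h C : ℝ} (hlow : ∀ m : ℕ, Real.exp (h * m) ≤ b m)
    (hup : ∀ m : ℕ, (b m : ℝ) ≤ C * Real.exp (9 / 8 * h * m)) (hh : 0 < h) (hC : 1 ≤ C)
    (k c d L m : ℕ) :
    (((b (m / 4) * d) ^ 2 + b (m / 4) * d * c * (d * b (m - (m / 4 + m / 4)) * d) +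
      k * (2 * (L + 1 + (L + 1)) * (d * b (m - m / 4))) : ℕ) : ℝ) ≤
    (d ^ 2 + c * d ^ 3 + 4 * k * (L + 1) * d) *
      (C ^ 2 * Real.exp (9 / 8 * h) * Real.exp (27 / 32 * h * m)) := by
  have hE : ∀ i j : ℕ, 4 * (i + j) ≤ 3 * m + 4 → (b i * b j : ℝ) ≤
      C ^ 2 * Real.exp (9 / 8 * h) * Real.exp (27 / 32 * h * m) := by
    intro i j hij
    calc (b i * b j : ℝ) ≤ (C * Real.exp (9 / 8 * h * i)) * (C * Real.exp (9 / 8 * h * j)) :=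
          mul_le_mul (hup i) (hup j) (Nat.cast_nonneg _) (by positivity)
      _ = C ^ 2 * Real.exp (9 / 8 * h * (i + j)) := by rw [mul_add, Real.exp_add]; ring
      _ ≤ C ^ 2 * Real.exp (9 / 8 * h + 27 / 32 * h * m) := by
          gcongr
          have : (4 * (i + j) : ℝ) ≤ 3 * m + 4 := by exact_mod_cast hij
          nlinarith
      _ = _ := by rw [Real.exp_add]; ring
  have h1 := hE (m / 4) (m / 4) (by omega)
  have h2 := hE (m / 4) (m - (m / 4 + m / 4)) (by omega)
  have h3 := hE 0 (m - m / 4) (by omega)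
  have h0 : (1 : ℝ) ≤ b 0 := by simpa using hlow 0
  set E := C ^ 2 * Real.exp (9 / 8 * h) * Real.exp (27 / 32 * h * m)
  have h4 : (b (m - m / 4) : ℝ) ≤ E :=
    (le_mul_of_one_le_left (Nat.cast_nonneg _) h0).trans h3
  push_cast
  have g1 : ((b (m / 4) : ℝ) * d) ^ 2 ≤ d ^ 2 * E := by
    calc _ = (d : ℝ) ^ 2 * (b (m / 4) * b (m / 4)) := by ring
      _ ≤ _ := by gcongr
  have g2 : (b (m / 4) : ℝ) * d * c * (d * b (m - (m / 4 + m / 4)) * d) ≤ c * d ^ 3 * E := by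
    calc _ = (c : ℝ) * d ^ 3 * (b (m / 4) * b (m - (m / 4 + m / 4))) := by ring
      _ ≤ _ := by gcongr
  have g3 : (k : ℝ) * (2 * (L + 1 + (L + 1)) * (d * b (m - m / 4))) ≤ 4 * k * (L + 1) * d * E := by
    calc _ = 4 * (k : ℝ) * (L + 1) * d * b (m - m / 4) := by ring
      _ ≤ _ := by gcongr
  linarith

/-- A finitely generated group of exponential growth whose balls of radius `m` map injectively
to a free group, the generators being sent to elements of length polynomial in `m`, has the
strong generic free group property. -/
theorem strongGenericFreeGroupProperty_of_polynomial {G : Type*} [Group G] {S : Set G}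
    (hS : S.Finite) {K : ℕ} (hK : 0 < K) (hgrow : ∀ m, 2 ^ m ≤ (wordBall S (K * m)).ncard)
    {P : Polynomial ℕ} (hP : ∀ m, ∃ Φ : G →* FreeGroup (Fin 2), (∀ s ∈ S, (Φ s).norm ≤ P.eval m) ∧
      ∀ x ∈ wordBall S m, Φ x = 1 → x = 1) :
    StrongGenericFreeGroupProperty S := by
  intro n hn
  obtain ⟨k, rfl⟩ := Nat.exists_eq_add_of_le' hn
  have hpos := ncard_wordBall_pos hS
  obtain ⟨h, hh, C, hC, hlow, hup⟩ := exists_exp_bounds hpos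
    (fun m m' hm => Set.ncard_le_ncard (wordBall_mono hm) (finite_wordBall hS m'))
    (ncard_wordBall_add_le hS) hK hgrow
  set b : ℕ → ℕ := fun m => (wordBall S m).ncard with hb
  set good : ℕ → ℕ := fun m =>
    {x : Fin (k + 1) → G | (∀ i, x i ∈ wordBall S m) ∧ IsFreeBasisTuple x}.ncard with hg
  set c := {c : FreeGroup (Fin 2) | c.norm ≤ 1}.ncard
  set P₂ : Polynomial ℕ := P.comp (2 * Polynomial.X)
  set D : Polynomial ℕ := 1 + (S.ncard + S.ncard : ℕ) * (P₂ + 1)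
  set Q : Polynomial ℕ := ((k : Polynomial ℕ) + 1) *
    (D ^ 2 + (c : Polynomial ℕ) * D ^ 3 + 4 * (k : Polynomial ℕ) * (Polynomial.X * P₂ + 1) * D)
    with hQ
  have hcount : ∀ m, b m ^ (k + 1) ≤ good m + (k + 1) * (b m ^ k *
      ((b (m / 4) * D.eval m) ^ 2 +
        b (m / 4) * D.eval m * c * (D.eval m * b (m - (m / 4 + m / 4)) * D.eval m) +
      k * (2 * (m * P₂.eval m + 1 + (m * P₂.eval m + 1)) * (D.eval m * b (m - m / 4))))) := by
    intro m
    obtain ⟨Φ, hL, hker⟩ := hP (2 * m)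
    have e : P.eval (2 * m) = P₂.eval m := by simp [P₂]
    rw [e] at hL
    obtain ⟨hD, hd⟩ := FreeGroup.finite_ncard_letterPrefixes_le hS hL
    refine ncard_wordBall_pow_le hS k (fun x hx y hy hxy => ?_)
      (fun x hx => FreeGroup.norm_map_le_of_mem_wordBall hL hx) hD
      (hd.trans_eq (by simp [D]))
    rw [← inv_mul_eq_one]
    refine hker _ ?_ (by rw [MonoidHom.map_mul, MonoidHom.map_inv, hxy, inv_mul_cancel])
    rw [two_mul]
    exact mul_mem_wordBall (inv_mem_wordBall hx) hy
  have hupper : ∀ m, (good m : ℝ) / (b m : ℝ) ^ (k + 1) ≤ 1 := by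
    intro m
    have hfin := Set.Finite.pi fun _ : Fin (k + 1) => finite_wordBall hS m
    refine div_le_one_of_le₀ ?_ (by positivity)
    have hcard : (Set.pi univ fun _ : Fin (k + 1) => wordBall S m).ncard = b m ^ (k + 1) := by
      classical
      have hf := finite_wordBall hS m
      have : (Set.pi univ fun _ : Fin (k + 1) => wordBall S m) =
          ↑(Fintype.piFinset fun _ : Fin (k + 1) => hf.toFinset) := by
        ext x
        simp
      rw [this, Set.ncard_coe_finset, Fintype.card_piFinset_const,
        ← Set.ncard_eq_toFinset_card _ hf]
    have : good m ≤ b m ^ (k + 1) :=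
      hcard ▸ Set.ncard_le_ncard (fun x hx i _ => hx.1 i) hfin
    exact_mod_cast this
  have hlower : ∀ m : ℕ, 1 - C ^ 2 * Real.exp (9 / 8 * h) *
      ((Q.map (Nat.castRingHom ℝ)).eval (m : ℝ) * Real.exp (-(5 / 32 * h * m))) ≤
      (good m : ℝ) / (b m : ℝ) ^ (k + 1) := by
    intro m
    have hbm : (0 : ℝ) < b m := Nat.cast_pos.2 (hpos m)
    have hbad := bad_count_le hlow hup hh hC k c (D.eval m) (m * P₂.eval m) m
    have hcm := hcount m
    set κ := (b (m / 4) * D.eval m) ^ 2 +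
        b (m / 4) * D.eval m * c * (D.eval m * b (m - (m / 4 + m / 4)) * D.eval m) +
      k * (2 * (m * P₂.eval m + 1 + (m * P₂.eval m + 1)) * (D.eval m * b (m - m / 4))) with hκ
    have hcm' : (b m : ℝ) ^ (k + 1) ≤ good m + (k + 1) * (b m ^ k * κ) := by exact_mod_cast hcm
    have hQm : (Q.map (Nat.castRingHom ℝ)).eval (m : ℝ) = (k + 1) * ((D.eval m : ℕ) ^ 2 +
        c * (D.eval m : ℕ) ^ 3 + 4 * k * ((m * P₂.eval m : ℕ) + 1) * (D.eval m : ℕ)) := by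
      have : (Q.map (Nat.castRingHom ℝ)).eval (m : ℝ) = ((Q.eval m : ℕ) : ℝ) := by
        rw [Polynomial.eval_natCast_map]
        simp
      rw [this, hQ]
      simp
    have hexp : Real.exp (27 / 32 * h * m) ≤ b m * Real.exp (-(5 / 32 * h * m)) := by
      calc _ = Real.exp (h * m) * Real.exp (-(5 / 32 * h * m)) := by
            rw [← Real.exp_add]; congr 1; ring
        _ ≤ _ := by gcongr; exact hlow m
    rw [le_div_iff₀ (by positivity)]
    have hκ' : (k + 1) * (κ : ℝ) ≤ C ^ 2 * Real.exp (9 / 8 * h) *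
      ((Q.map (Nat.castRingHom ℝ)).eval (m : ℝ) * Real.exp (-(5 / 32 * h * m))) * b m := by
      rw [hQm]
      calc (k + 1) * (κ : ℝ) ≤ (k + 1) * (((D.eval m : ℕ) ^ 2 +
          c * (D.eval m : ℕ) ^ 3 + 4 * k * ((m * P₂.eval m : ℕ) + 1) * (D.eval m : ℕ)) *
          (C ^ 2 * Real.exp (9 / 8 * h) * (b m * Real.exp (-(5 / 32 * h * m))))) := by
            gcongr
            refine hbad.trans ?_
            gcongr
        _ = _ := by ring
    have := mul_le_mul_of_nonneg_right hκ' (pow_nonneg hbm.le k)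
    rw [sub_mul, one_mul, pow_succ]
    rw [pow_succ] at hcm'
    linarith
  refine tendsto_of_tendsto_of_tendsto_of_le_of_le ?_ tendsto_const_nhds hlower hupper
  have := (tendsto_eval_mul_exp_neg (Q.map (Nat.castRingHom ℝ))
    (show 0 < 5 / 32 * h by positivity)).const_mul (C ^ 2 * Real.exp (9 / 8 * h))
  simpa using this.const_sub 1

namespace NonorientableSurfaceGroup

/-- The first two generators of a nonorientable surface group of genus at least four map to a
free basis of the free group of rank two. -/
theorem exists_hom_freeGroup (n : ℕ) : ∃ (a : Fin 2 → NonorientableSurfaceGroup (n + 4))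
    (ψ : NonorientableSurfaceGroup (n + 4) →* FreeGroup (Fin 2)),
    ∀ i, ψ (a i) = FreeGroup.of i := by
  let x : FreeGroup (Fin 2) := FreeGroup.of 0
  let y : FreeGroup (Fin 2) := FreeGroup.of 1
  let t : Fin (n + 4) → FreeGroup (Fin 2) :=
    Fin.cons x (Fin.cons y (Fin.cons y⁻¹ (Fin.cons x⁻¹ fun _ => 1)))
  have ht : FreeGroup.lift t (nonorientableSurfaceRelator (n + 4)) = 1 := by
    rw [nonorientableSurfaceRelator, map_list_prod, List.map_ofFn]
    simp only [Function.comp_def, MonoidHom.map_pow, FreeGroup.lift_apply_of, List.ofFn_succ, t,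
      Fin.cons_zero, Fin.cons_succ, one_pow, List.ofFn_const, List.prod_cons, List.prod_replicate]
    group
  refine ⟨![of 0, of 1], lift t ht, fun i => ?_⟩
  fin_cases i
  · simp [t, x]
  · change lift t ht (of (Fin.succ 0)) = _
    simp [t, y]

theorem two_pow_le_ncard_wordBall {G : Type*} [Group G] {S : Set G} (hS : S.Finite) {K : ℕ}
    (a : Fin 2 → G) (ha : ∀ i, a i ∈ wordBall S K) (ψ : G →* FreeGroup (Fin 2))
    (hψ : ∀ i, ψ (a i) = FreeGroup.of i) (m : ℕ) : 2 ^ m ≤ (wordBall S (K * m)).ncard := by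
  have hpos : ∀ L : List (Fin 2), ψ (L.map a).prod = FreeGroup.positive L := by
    intro L
    induction L with
    | nil => simp [FreeGroup.positive, FreeGroup.one_eq_mk]
    | cons i L ih =>
      rw [List.map_cons, List.prod_cons, MonoidHom.map_mul, ih, hψ,
        ← List.singleton_append, FreeGroup.positive_append]
      rfl
  have hcard : (univ : Set (Fin m → Fin 2)).ncard = 2 ^ m := by simp [Set.ncard_univ]
  rw [← hcard]
  refine Set.ncard_le_ncard_of_injOn (fun f => ((List.ofFn f).map a).prod) (fun f _ => ?_)
    (fun f _ f' _ h => ?_) (finite_wordBall hS _)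
  · have := list_prod_mem_wordBall (S := S) (k := K) (l := (List.ofFn f).map a) (by simp [ha])
    simpa using this
  · have h' := congrArg ψ h
    simp only [hpos] at h'
    exact List.ofFn_injective (FreeGroup.positive_injective h')

end NonorientableSurfaceGroup

/-- For every `g ≥ 4`, the nonorientable surface group of genus `g` satisfies the strong
generic free group property with respect to every finite generating set. -/
theorem nonorientableSurfaceGroup_hasStrongGenericFreeGroupProperty (g : ℕ) (hg : 4 ≤ g) :
    HasStrongGenericFreeGroupProperty (NonorientableSurfaceGroup g) := by
  obtain ⟨n, rfl⟩ := Nat.exists_eq_add_of_le' hg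
  intro S hS hgen
  obtain ⟨K, hK⟩ := exists_subset_wordBall (NonorientableSurfaceGroup.closure_range_of (n + 4)) hS
  obtain ⟨P, hP⟩ := NonorientableSurfaceGroup.exists_polynomial n
  obtain ⟨a, ψ, hψ⟩ := NonorientableSurfaceGroup.exists_hom_freeGroup n
  obtain ⟨k, hk⟩ := exists_subset_wordBall hgen (Set.finite_range a)
  refine strongGenericFreeGroupProperty_of_polynomial hS k.succ_pos
    (NonorientableSurfaceGroup.two_pow_le_ncard_wordBall hS a
      (fun i => wordBall_mono k.le_succ (hk ⟨i, rfl⟩)) ψ hψ)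
    (P := Polynomial.C K * P.comp (Polynomial.C K * Polynomial.X)) fun m => ?_
  obtain ⟨Φ, hL, hker⟩ := hP (K * m)
  refine ⟨Φ, fun s hs => ?_, fun x hx => hker x (wordBall_subset_wordBall hK m hx)⟩
  have := FreeGroup.norm_map_le_of_mem_wordBall (Φ := Φ) (L := P.eval (K * m))
    (by rintro _ ⟨i, rfl⟩; exact hL i) (hK hs)
  simpa using this
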